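/- arXiv:1307.1338 — 2 statements merged into one kernel-verified Lean document; each statement's English description precedes it below -/
import Mathlib

section
/- Let Ω be a bounded domain in ℝⁿ, n ≥ 2, let p ≥ 1 and a, b ∈ ℝ. Then the following are equivalent: (i) there exists C > 0 such that for every u ∈ C^∞(Ω), ∫_Ω |u(x) − u_{Ω,a}|^p ρ(x)^a dx ≤ C ∫_Ω |∇u(x)|^p ρ(x)^b dx; (ii) for an arbitrary cube Q compactly contained in Ω there exists C = C(Q) > 0 such that ∫_A ρ(x)^a dx ≤ C inf_u ∫_Ω |∇u(x)|^p ρ(x)^b dx for every admissible set A ⊂ Ω with A ∩ Q = ∅, where the infimum is taken over all u ∈ C^∞(Ω) with u ≡ 1 on A and u ≡ 0 on Q. -/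
open MeasureTheory Set Filter
open scoped ENNReal NNReal Topology

noncomputable section

abbrev Evec (n : ℕ) := EuclideanSpace ℝ (Fin n)

/-- `ρ(x) = dist(x, ∂Ω)`, the distance to the boundary of `Ω`. -/
def bdist {n : ℕ} (Ω : Set (Evec n)) (x : Evec n) : ℝ := Metric.infDist x (frontier Ω)

/-- A bounded domain: open, connected and bounded. -/
def IsBoundedDomain {n : ℕ} (Ω : Set (Evec n)) : Prop :=
  IsOpen Ω ∧ IsConnected Ω ∧ Bornology.IsBounded Ω

/-- A closed cube in `ℝⁿ`. -/
def IsClosedCube {n : ℕ} (Q : Set (Evec n)) : Prop :=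
  ∃ (c : Evec n) (r : ℝ), 0 < r ∧ Q = {x : Evec n | ∀ i, |x i - c i| ≤ r}

/-- The weighted `p`-energy `∫_S |g(x)|^p ρ(x)^a dx`, where `ρ` is the distance
to the boundary of `Ω`. -/
def wIp {n : ℕ} (Ω S : Set (Evec n)) (p a : ℝ) (g : Evec n → ℝ) : ℝ≥0∞ :=
  ∫⁻ x in S, ENNReal.ofReal (|g x| ^ p * bdist Ω x ^ a)

/-- The weighted `L^p(S, ρ^a)` norm `(∫_S |g(x)|^p ρ(x)^a dx)^{1/p}`. -/
def wLp {n : ℕ} (Ω S : Set (Evec n)) (p a : ℝ) (g : Evec n → ℝ) : ℝ≥0∞ :=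
  wIp Ω S p a g ^ (1 / p)

/-- The weighted average `u_{Ω,a} = (∫_Ω ρ^a)⁻¹ ∫_Ω u ρ^a`. -/
def wAvg {n : ℕ} (Ω : Set (Evec n)) (a : ℝ) (u : Evec n → ℝ) : ℝ :=
  (∫ x in Ω, bdist Ω x ^ a)⁻¹ * ∫ x in Ω, u x * bdist Ω x ^ a

/-- `|∇u(x)|` for a scalar function `u`. -/
def gradLen {n : ℕ} (u : Evec n → ℝ) (x : Evec n) : ℝ := ‖fderiv ℝ u x‖

/-- The entry `∂v_i/∂x_j (x)` of the gradient matrix `Dv`. -/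
def pder {n : ℕ} (v : Evec n → Evec n) (i j : Fin n) (x : Evec n) : ℝ :=
  fderiv ℝ v x (EuclideanSpace.single j 1) i

/-- `|Dv(x)|`, the (Frobenius) norm of the gradient matrix of a vector field `v`. -/
def DvLen {n : ℕ} (v : Evec n → Evec n) (x : Evec n) : ℝ :=
  Real.sqrt (∑ i, ∑ j, pder v i j x ^ 2)

/-- `|ε(v)(x)|`, the norm of the symmetric part `ε_{ij}(v) = (∂v_i/∂x_j + ∂v_j/∂x_i)/2`
of the gradient matrix. -/
def epsLen {n : ℕ} (v : Evec n → Evec n) (x : Evec n) : ℝ :=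
  Real.sqrt (∑ i, ∑ j, ((pder v i j x + pder v j i x) / 2) ^ 2)

/-- `u ∈ W^{1,p}(Ω, ρ^a, ρ^b)` (scalar case). -/
def MemW1 {n : ℕ} (Ω : Set (Evec n)) (p a b : ℝ) (u : Evec n → ℝ) : Prop :=
  DifferentiableOn ℝ u Ω ∧ wIp Ω Ω p a u < ⊤ ∧ wIp Ω Ω p b (gradLen u) < ⊤

/-- `v ∈ W^{1,p}(Ω, ρ^a, ρ^b)ⁿ` (vector case). -/
def MemW1Vec {n : ℕ} (Ω : Set (Evec n)) (p a b : ℝ) (v : Evec n → Evec n) : Prop :=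
  DifferentiableOn ℝ v Ω ∧ wIp Ω Ω p a (fun x => ‖v x‖) < ⊤ ∧ wIp Ω Ω p b (DvLen v) < ⊤

/-- The weighted Poincaré inequality `(P_{p,a,b})`: there is `C > 0` such that
`∫_Ω |u - u_{Ω,a}|^p ρ^a ≤ C ∫_Ω |∇u|^p ρ^b` for all `u ∈ W^{1,p}(Ω,ρ^a,ρ^b)`. -/
def PoincareIneq {n : ℕ} (Ω : Set (Evec n)) (p a b : ℝ) : Prop :=
  ∃ C > 0, ∀ u : Evec n → ℝ, MemW1 Ω p a b u →
    wIp Ω Ω p a (fun x => u x - wAvg Ω a u) ≤ ENNReal.ofReal C * wIp Ω Ω p b (gradLen u)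

/-- An admissible subset `A ⊆ Ω`: `A` is open and `∂A ∩ Ω` is a smooth hypersurface
(locally the zero set of a smooth function with nonvanishing differential). -/
def IsAdmissible {n : ℕ} (Ω A : Set (Evec n)) : Prop :=
  IsOpen A ∧ A ⊆ Ω ∧ ∀ x ∈ frontier A ∩ Ω, ∃ (U : Set (Evec n)) (f : Evec n → ℝ),
    IsOpen U ∧ x ∈ U ∧ ContDiff ℝ (⊤ : ℕ∞) f ∧ (∀ y ∈ U, fderiv ℝ f y ≠ 0) ∧
    frontier A ∩ U = {y ∈ U | f y = 0}

section Capacity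

variable {n : ℕ} {Ω : Set (Evec n)}

lemma IsBoundedDomain.nonempty_frontier (hn : 2 ≤ n) (hΩ : IsBoundedDomain Ω) :
    (frontier Ω).Nonempty := by
  obtain ⟨-, hc, hb⟩ := hΩ
  have : Nontrivial (Fin n) := Fin.nontrivial_iff_two_le.2 hn
  by_contra h
  rw [not_nonempty_iff_eq_empty, ← isClopen_iff_frontier_eq_empty] at h
  rw [h.eq_univ hc.nonempty] at hb
  exact NormedSpace.unbounded_univ ℝ (Evec n) hb

lemma continuous_bdist (Ω : Set (Evec n)) : Continuous (bdist Ω) :=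
  Metric.continuous_infDist_pt _

lemma IsBoundedDomain.bdist_pos (hn : 2 ≤ n) (hΩ : IsBoundedDomain Ω) {x : Evec n} (hx : x ∈ Ω) :
    0 < bdist Ω x := by
  refine (isClosed_frontier.notMem_iff_infDist_pos (hΩ.nonempty_frontier hn)).1 fun h => ?_
  rw [hΩ.1.frontier_eq] at h
  exact h.2 hx

/-- The measure `ρ^a dx` on `Ω`. -/
def weightMeasure (Ω : Set (Evec n)) (a : ℝ) : Measure (Evec n) :=
  (volume.restrict Ω).withDensity fun x => ENNReal.ofReal (bdist Ω x ^ a)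

lemma measurable_weight (Ω : Set (Evec n)) (a : ℝ) :
    Measurable fun x => ENNReal.ofReal (bdist Ω x ^ a) :=
  ((continuous_bdist Ω).measurable.pow_const a).ennreal_ofReal

lemma weightMeasure_absolutelyContinuous (Ω : Set (Evec n)) (a : ℝ) :
    weightMeasure Ω a ≪ volume :=
  (withDensity_absolutelyContinuous _ _).trans Measure.absolutelyContinuous_restrict

lemma ae_mem_weightMeasure (hΩ : IsOpen Ω) (a : ℝ) : ∀ᵐ x ∂weightMeasure Ω a, x ∈ Ω :=
  (withDensity_absolutelyContinuous _ _).ae_le (ae_restrict_mem hΩ.measurableSet)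

lemma lintegral_weightMeasure (Ω : Set (Evec n)) (a : ℝ) (g : Evec n → ℝ≥0∞) :
    ∫⁻ x, g x ∂weightMeasure Ω a = ∫⁻ x in Ω, ENNReal.ofReal (bdist Ω x ^ a) * g x :=
  lintegral_withDensity_eq_lintegral_mul_non_measurable _ (measurable_weight Ω a)
    (ae_of_all _ fun _ => ENNReal.ofReal_lt_top) g

lemma wIp_eq_lintegral_weightMeasure (Ω : Set (Evec n)) {p : ℝ} (hp : 0 ≤ p) (a : ℝ)
    (g : Evec n → ℝ) : wIp Ω Ω p a g = ∫⁻ x, ‖g x‖ₑ ^ p ∂weightMeasure Ω a := by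
  rw [lintegral_weightMeasure, wIp]
  refine lintegral_congr fun x => ?_
  rw [ENNReal.ofReal_mul (by positivity), mul_comm, ← ENNReal.ofReal_rpow_of_nonneg (abs_nonneg _) hp,
    Real.enorm_eq_ofReal_abs]

lemma wIp_gradLen_eq_lintegral_weightMeasure (Ω : Set (Evec n)) {p : ℝ} (hp : 0 ≤ p) (b : ℝ)
    (u : Evec n → ℝ) :
    wIp Ω Ω p b (gradLen u) = ∫⁻ x, ‖fderiv ℝ u x‖ₑ ^ p ∂weightMeasure Ω b := by
  simp only [wIp_eq_lintegral_weightMeasure Ω hp, gradLen, enorm_norm]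

lemma weightMeasure_apply {A : Set (Evec n)} (hA : MeasurableSet A) (hAΩ : A ⊆ Ω) (a : ℝ) :
    weightMeasure Ω a A = ∫⁻ x in A, ENNReal.ofReal (bdist Ω x ^ a) := by
  rw [weightMeasure, withDensity_apply _ hA, Measure.restrict_restrict hA,
    inter_eq_left.2 hAΩ]

lemma wAvg_eq_average (Ω : Set (Evec n)) (a : ℝ) (u : Evec n → ℝ) :
    wAvg Ω a u = ⨍ x, u x ∂weightMeasure Ω a := by
  have h0 : ∀ x, 0 ≤ bdist Ω x ^ a := fun x => Real.rpow_nonneg Metric.infDist_nonneg _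
  have key : ∀ v : Evec n → ℝ,
      ∫ x, v x ∂weightMeasure Ω a = ∫ x in Ω, v x * bdist Ω x ^ a := fun v => by
    rw [weightMeasure, integral_withDensity_eq_integral_toReal_smul (measurable_weight Ω a)
      (ae_of_all _ fun _ => ENNReal.ofReal_lt_top)]
    simp only [ENNReal.toReal_ofReal (h0 _), smul_eq_mul, mul_comm]
  have h1 := key fun _ => 1
  simp only [one_mul, integral_const, smul_eq_mul, mul_one] at h1
  rw [wAvg, average_eq, key, ← h1, smul_eq_mul]

lemma frontier_biUnion_ball_inter {s : Finset (Evec n)} {r : Evec n → ℝ} (hr : ∀ x ∈ s, 0 < r x)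
    {c : Evec n} (hc : c ∈ s) {y : Evec n}
    (hy : ∀ x ∈ s, x ≠ c → y ∉ Metric.closedBall x (r x)) :
    y ∈ frontier (⋃ x ∈ s, Metric.ball x (r x)) ↔ dist y c = r c := by
  have hclos : closure (⋃ x ∈ s, Metric.ball x (r x)) = ⋃ x ∈ s, Metric.closedBall x (r x) := by
    rw [Finset.closure_biUnion]
    exact iUnion₂_congr fun x hx => closure_ball _ (hr x hx).ne'
  have ho : IsOpen (⋃ x ∈ s, Metric.ball x (r x)) := isOpen_biUnion fun _ _ => Metric.isOpen_ball
  rw [ho.frontier_eq, hclos]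
  simp only [Set.mem_sdiff, mem_iUnion, exists_prop, not_exists, not_and]
  constructor
  · rintro ⟨⟨x, hx, hyx⟩, h2⟩
    obtain rfl : x = c := by
      by_contra h
      exact hy x hx h hyx
    have := h2 x hx
    rw [Metric.mem_ball, not_lt] at this
    exact le_antisymm hyx this
  · intro h
    refine ⟨⟨c, hc, h.le⟩, fun x hx hyx => ?_⟩
    by_cases hxc : x = c
    · subst hxc
      exact h.not_lt hyx
    · exact hy x hx hxc (Metric.ball_subset_closedBall hyx)

lemma isAdmissible_biUnion_ball {s : Finset (Evec n)} {r : Evec n → ℝ} (hr : ∀ x ∈ s, 0 < r x)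
    (hd : (s : Set (Evec n)).PairwiseDisjoint fun x => Metric.closedBall x (r x))
    (hs : ∀ x ∈ s, Metric.ball x (r x) ⊆ Ω) :
    IsAdmissible Ω (⋃ x ∈ s, Metric.ball x (r x)) := by
  have ho : IsOpen (⋃ x ∈ s, Metric.ball x (r x)) := isOpen_biUnion fun _ _ => Metric.isOpen_ball
  refine ⟨ho, iUnion₂_subset hs, ?_⟩
  rintro z ⟨hz, -⟩
  obtain ⟨c, hc, hzc⟩ : ∃ c ∈ s, z ∈ Metric.closedBall c (r c) := by
    have h := frontier_subset_closure hz
    rw [Finset.closure_biUnion] at h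
    simp only [mem_iUnion, exists_prop] at h
    obtain ⟨c, hc, h⟩ := h
    exact ⟨c, hc, Metric.closure_ball_subset_closedBall h⟩
  have hzx : ∀ x ∈ s, x ≠ c → z ∉ Metric.closedBall x (r x) := fun x hx hxc h =>
    disjoint_left.1 (hd hx hc hxc) h hzc
  have hzne : z ≠ c := by
    have := (frontier_biUnion_ball_inter hr hc hzx).1 hz
    rw [← dist_pos, this]
    exact hr c hc
  have hclosed : IsClosed (⋃ x ∈ s.erase c, Metric.closedBall x (r x)) :=
    (s.erase c).finite_toSet.isClosed_biUnion fun _ _ => Metric.isClosed_closedBall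
  refine ⟨{c}ᶜ ∩ (⋃ x ∈ s.erase c, Metric.closedBall x (r x))ᶜ,
    fun y => ‖y - c‖ ^ 2 - r c ^ 2, isOpen_compl_singleton.inter hclosed.isOpen_compl,
    ⟨hzne, ?_⟩, ((contDiff_id.sub contDiff_const).norm_sq ℝ).sub contDiff_const, ?_, ?_⟩
  · simp only [mem_compl_iff, mem_iUnion, not_exists]
    exact fun x hx => hzx x (Finset.mem_of_mem_erase hx) (Finset.ne_of_mem_erase hx)
  · rintro y ⟨hyc, -⟩ h0
    have hd : HasFDerivAt (fun y : Evec n => ‖y - c‖ ^ 2 - r c ^ 2)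
        (2 • (innerSL ℝ (y - c)).comp (ContinuousLinearMap.id ℝ (Evec n))) y :=
      (((hasFDerivAt_id y).sub_const c).norm_sq).sub_const _
    rw [hd.fderiv] at h0
    have h1 := congrArg (fun L : Evec n →L[ℝ] ℝ => L (y - c)) h0
    have h2 : inner ℝ (y - c) (y - c) = 0 := by
      rw [inner_sub_left]
      simpa using h1
    exact hyc (sub_eq_zero.1 (inner_self_eq_zero.1 h2))
  · ext y
    refine ⟨fun ⟨h1, h2⟩ => ⟨h2, ?_⟩, fun ⟨h2, h1⟩ => ⟨?_, h2⟩⟩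
    all_goals
      have hyx : ∀ x ∈ s, x ≠ c → y ∉ Metric.closedBall x (r x) := fun x hx hxc h =>
        h2.2 (mem_biUnion (Finset.mem_erase.2 ⟨hxc, hx⟩) h)
      rw [frontier_biUnion_ball_inter hr hc hyx, dist_eq_norm] at *
    · simp [h1]
    · exact (sq_eq_sq₀ (norm_nonneg _) (hr c hc).le).1 (sub_eq_zero.1 h1)

lemma measure_le_of_forall_isAdmissible {μ : Measure (Evec n)} (hμ : μ ≪ volume)
    {A : Set (Evec n)} (hA : IsOpen A) (hAΩ : A ⊆ Ω) {K : ℝ≥0∞}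
    (h : ∀ B, IsAdmissible Ω B → B ⊆ A → μ B ≤ K) : μ A ≤ K := by
  obtain ⟨t, r, htc, htA, htr, hcov, hd⟩ := Besicovitch.exists_disjoint_closedBall_covering_ae
    (volume : Measure (Evec n)) (fun x => {ρ | Metric.closedBall x ρ ⊆ A}) A
    (fun x hx δ hδ => by
      obtain ⟨ε, hε, hb⟩ := Metric.nhds_basis_closedBall.mem_iff.1 (hA.mem_nhds hx)
      refine ⟨min ε (δ / 2), (Metric.closedBall_subset_closedBall (min_le_left _ _)).trans hb, ?_, ?_⟩
      · positivity
      · exact (min_le_right _ _).trans_lt (half_lt_self hδ))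
    (fun _ => 1) (fun _ _ => one_pos)
  have hball : ∀ x ∈ t, μ (Metric.closedBall x (r x)) ≤ μ (Metric.ball x (r x)) := fun x hx => by
    rw [← Metric.ball_union_sphere]
    refine (measure_union_le _ _).trans_eq ?_
    rw [hμ (Measure.addHaar_sphere_of_ne_zero volume x (htr x hx).2.1.ne'), add_zero]
  have : Countable t := htc.to_subtype
  have hle : μ A ≤ μ (⋃ x ∈ t, Metric.closedBall x (r x)) :=
    measure_mono_ae (ae_le_set.2 (hμ hcov))
  refine hle.trans ?_
  rw [measure_biUnion htc hd fun _ _ => Metric.isClosed_closedBall.measurableSet,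
    ENNReal.tsum_eq_iSup_sum]
  refine iSup_le fun s => ?_
  have hst : ∀ x ∈ s.map (Function.Embedding.subtype _), x ∈ t := by
    intro x hx
    obtain ⟨y, -, rfl⟩ := Finset.mem_map.1 hx
    exact y.2
  have hd' : ((s.map (Function.Embedding.subtype _) : Finset (Evec n)) :
      Set (Evec n)).PairwiseDisjoint fun x => Metric.closedBall x (r x) :=
    hd.subset fun x hx => hst x hx
  have hsub : ∀ x ∈ s.map (Function.Embedding.subtype _), Metric.ball x (r x) ⊆ A := fun x hx =>
    Metric.ball_subset_closedBall.trans (htr x (hst x hx)).1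
  calc ∑ x ∈ s, μ (Metric.closedBall (x : Evec n) (r x))
      ≤ ∑ x ∈ s.map (Function.Embedding.subtype _), μ (Metric.ball x (r x)) := by
        rw [Finset.sum_map]
        exact Finset.sum_le_sum fun x _ => hball x x.2
    _ = μ (⋃ x ∈ s.map (Function.Embedding.subtype _), Metric.ball x (r x)) :=
        (measure_biUnion_finset (hd'.mono fun _ => Metric.ball_subset_closedBall)
          fun _ _ => Metric.isOpen_ball.measurableSet).symm
    _ ≤ K := h _ (isAdmissible_biUnion_ball (fun x hx => (htr x (hst x hx)).2.1) hd'
        fun x hx => (hsub x hx).trans hAΩ) (iUnion₂_subset hsub)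

lemma rpow_lintegral_le_lintegral_rpow {α : Type*} [MeasurableSpace α] {μ : Measure α}
    [IsProbabilityMeasure μ] {f : α → ℝ≥0∞} (hf : AEMeasurable f μ) {p : ℝ} (hp : 1 ≤ p) :
    (∫⁻ x, f x ∂μ) ^ p ≤ ∫⁻ x, f x ^ p ∂μ := by
  have hp0 : 0 < p := one_pos.trans_le hp
  have h := eLpNorm_le_eLpNorm_of_exponent_le (p := 1) (q := ENNReal.ofReal p)
    (by simpa using hp) hf.aestronglyMeasurable
  rw [eLpNorm_one_eq_lintegral_enorm, eLpNorm_eq_lintegral_rpow_enorm_toReal (by simpa using hp0)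
    ENNReal.ofReal_ne_top, ENNReal.toReal_ofReal hp0.le] at h
  simp only [enorm_eq_self] at h
  calc _ ≤ _ := ENNReal.rpow_le_rpow h hp0.le
    _ = _ := by rw [← ENNReal.rpow_mul, one_div, inv_mul_cancel₀ hp0.ne', ENNReal.rpow_one]

lemma enorm_sub_rpow_le_lintegral_segment (hΩ : IsOpen Ω) {u : Evec n → ℝ}
    (hu : ContDiffOn ℝ 1 u Ω) {K : Set (Evec n)} (hK : Convex ℝ K) (hKΩ : K ⊆ Ω) {p : ℝ}
    (hp : 1 ≤ p) {x y : Evec n} (hx : x ∈ K) (hy : y ∈ K) :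
    ‖u y - u x‖ₑ ^ p ≤
      ‖y - x‖ₑ ^ p * ∫⁻ t in Icc (0 : ℝ) 1, ‖fderiv ℝ u ((1 - t) • x + t • y)‖ₑ ^ p := by
  have hp0 : 0 < p := one_pos.trans_le hp
  have hmem : ∀ t ∈ Icc (0 : ℝ) 1, (1 - t) • x + t • y ∈ Ω := fun t ht =>
    hKΩ (hK hx hy (sub_nonneg.2 ht.2) ht.1 (by ring))
  have hγ : ContDiff ℝ 1 fun t : ℝ => (1 - t) • x + t • y := by fun_prop
  have hder : ∀ t ∈ Icc (0 : ℝ) 1, ‖deriv (fun t : ℝ => u ((1 - t) • x + t • y)) t‖ₑ ≤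
      ‖fderiv ℝ u ((1 - t) • x + t • y)‖ₑ * ‖y - x‖ₑ := fun t ht => by
    have h1 : HasDerivAt (fun t : ℝ => (1 - t) • x + t • y) (y - x) t := by
      have := (((hasDerivAt_id t).const_sub 1).smul_const x).add ((hasDerivAt_id t).smul_const y)
      rw [neg_one_smul, one_smul, neg_add_eq_sub] at this
      exact this
    have h2 := ((hu.contDiffAt (hΩ.mem_nhds (hmem t ht))).differentiableAt one_ne_zero).hasFDerivAt
    have h3 : deriv (fun t : ℝ => u ((1 - t) • x + t • y)) t = _ :=
      (h2.comp_hasDerivAt t h1).deriv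
    rw [h3]
    exact ContinuousLinearMap.le_opENorm _ _
  have h := enorm_sub_le_lintegral_deriv_of_contDiffOn_Icc
    (f := fun t : ℝ => u ((1 - t) • x + t • y)) (hu.comp hγ.contDiffOn hmem) zero_le_one
  simp only [sub_self, zero_smul, one_smul, zero_add, sub_zero, add_zero] at h
  have : IsProbabilityMeasure (volume.restrict (Icc (0 : ℝ) 1)) := ⟨by simp⟩
  have hmeas : Measurable fun t : ℝ => ‖fderiv ℝ u ((1 - t) • x + t • y)‖ₑ :=
    ((measurable_fderiv ℝ u).comp hγ.continuous.measurable).enorm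
  have h' : ‖u y - u x‖ₑ ≤
      (∫⁻ t in Icc (0 : ℝ) 1, ‖fderiv ℝ u ((1 - t) • x + t • y)‖ₑ) * ‖y - x‖ₑ := by
    rw [← lintegral_mul_const _ hmeas]
    exact h.trans (setLIntegral_mono' measurableSet_Icc hder)
  calc _ ≤ _ := ENNReal.rpow_le_rpow h' hp0.le
    _ ≤ _ := by
      rw [ENNReal.mul_rpow_of_nonneg _ _ hp0.le, mul_comm]
      gcongr
      exact rpow_lintegral_le_lintegral_rpow hmeas.aemeasurable hp

lemma lintegral_comp_add_smul_le {g : Evec n → ℝ≥0∞} (hg : Measurable g) (z : Evec n) {t : ℝ}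
    (ht : 1 / 2 ≤ t) : ∫⁻ y, g (z + t • y) ≤ 2 ^ n * ∫⁻ y, g y := by
  have ht0 : 0 < t := by linarith
  have h1 : ∫⁻ y, g (z + t • y) = ∫⁻ v, g (z + v) ∂(Measure.map (fun y => t • y) volume) :=
    (lintegral_map (hg.comp (measurable_const_add z)) (measurable_const_smul t)).symm
  rw [h1, Measure.map_addHaar_smul _ ht0.ne', lintegral_smul_measure, lintegral_add_left_eq_self,
    finrank_euclideanSpace_fin, smul_eq_mul]
  gcongr
  rw [abs_of_pos (by positivity), ← inv_pow, ENNReal.ofReal_pow (by positivity)]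
  gcongr
  rw [show (2 : ℝ≥0∞) = ENNReal.ofReal 2 by simp]
  exact ENNReal.ofReal_le_ofReal (inv_le_of_inv_le₀ (by norm_num) (by linarith))

lemma lintegral_lintegral_lintegral_rotate {α β γ : Type*} [MeasurableSpace α] [MeasurableSpace β]
    [MeasurableSpace γ] (μ : Measure α) (ν : Measure β) (κ : Measure γ) [SFinite μ] [SFinite ν]
    [SFinite κ] {G : (α × β) × γ → ℝ≥0∞} (hG : Measurable G) :
    ∫⁻ y, ∫⁻ x, ∫⁻ t, G ((y, x), t) ∂κ ∂ν ∂μ = ∫⁻ t, ∫⁻ y, ∫⁻ x, G ((y, x), t) ∂ν ∂μ ∂κ := by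
  rw [← lintegral_prod (fun q => ∫⁻ t, G (q, t) ∂κ) hG.lintegral_prod_right'.aemeasurable,
    lintegral_lintegral_swap (f := fun q t => G (q, t)) hG.aemeasurable]
  exact lintegral_congr fun t => lintegral_prod _ (hG.comp measurable_prodMk_right).aemeasurable

lemma exists_lintegral_enorm_sub_rpow_le (hΩ : IsOpen Ω) {u : Evec n → ℝ}
    (hu : ContDiffOn ℝ 1 u Ω) {K : Set (Evec n)} (hK : Convex ℝ K) (hKm : MeasurableSet K)
    (hKΩ : K ⊆ Ω) {p : ℝ} (hp : 1 ≤ p) {D : ℝ≥0∞} (hD : ∀ x ∈ K, ∀ y ∈ K, ‖y - x‖ₑ ≤ D)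
    (hK0 : volume K ≠ 0) (hKt : volume K ≠ ⊤) :
    ∃ c : ℝ, ∫⁻ x in K, ‖u x - c‖ₑ ^ p ≤ D ^ p * (2 ^ n * ∫⁻ x in K, ‖fderiv ℝ u x‖ₑ ^ p) := by
  have hp0 : 0 < p := one_pos.trans_le hp
  set g : Evec n → ℝ≥0∞ := K.indicator fun x => ‖fderiv ℝ u x‖ₑ ^ p with hgdef
  have hg : Measurable g := ((measurable_fderiv ℝ u).enorm.pow_const p).indicator hKm
  have hgi : ∫⁻ x, g x = ∫⁻ x in K, ‖fderiv ℝ u x‖ₑ ^ p := lintegral_indicator hKm _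
  set F : Evec n → ℝ≥0∞ :=
    fun y => ∫⁻ x in K, ∫⁻ t in Icc (0 : ℝ) 1, g ((1 - t) • x + t • y) with hF
  have hG : Measurable fun q : (Evec n × Evec n) × ℝ => g ((1 - q.2) • q.1.2 + q.2 • q.1.1) :=
    hg.comp (by fun_prop)
  have hG' : Measurable fun q : Evec n × Evec n =>
      ∫⁻ t in Icc (0 : ℝ) 1, g ((1 - t) • q.2 + t • q.1) := hG.lintegral_prod_right'
  have hFm : Measurable F := hG'.lintegral_prod_right'
  obtain ⟨y, hy, hFy⟩ := exists_le_setLAverage hK0 hKt hFm.aemeasurable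
  refine ⟨u y, ?_⟩
  have h1 : ∫⁻ x in K, ‖u x - u y‖ₑ ^ p ≤ D ^ p * F y := by
    have h2 : D ^ p * F y =
        ∫⁻ x in K, D ^ p * ∫⁻ t in Icc (0 : ℝ) 1, g ((1 - t) • x + t • y) :=
      (lintegral_const_mul _ (hG'.comp (measurable_const (a := y).prodMk measurable_id))).symm
    rw [h2]
    refine setLIntegral_mono' hKm fun x hx => ?_
    rw [← enorm_neg, neg_sub]
    refine (enorm_sub_rpow_le_lintegral_segment hΩ hu hK hKΩ hp hx hy).trans ?_
    refine mul_le_mul' (ENNReal.rpow_le_rpow (hD x hx y hy) hp0.le)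
      (setLIntegral_mono' measurableSet_Icc fun t ht => ?_)
    rw [hgdef, indicator_of_mem (hK hx hy (sub_nonneg.2 ht.2) ht.1 (by ring))]
  refine h1.trans ?_
  gcongr
  refine hFy.trans ?_
  rw [setLAverage_eq]
  refine ENNReal.div_le_of_le_mul ?_
  rw [← hgi]
  have hswap : ∫⁻ y in K, F y =
      ∫⁻ t in Icc (0 : ℝ) 1, ∫⁻ y in K, ∫⁻ x in K, g ((1 - t) • x + t • y) := by
    exact lintegral_lintegral_lintegral_rotate (volume.restrict K) (volume.restrict K) _ hG
  have hslice : ∀ t ∈ Icc (0 : ℝ) 1,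
      ∫⁻ y in K, ∫⁻ x in K, g ((1 - t) • x + t • y) ≤ (2 ^ n * ∫⁻ x, g x) * volume K := by
    intro t ht
    by_cases h : 1 / 2 ≤ t
    · have hm : Measurable fun q : Evec n × Evec n => g ((1 - t) • q.2 + t • q.1) :=
        hg.comp (by fun_prop)
      rw [lintegral_lintegral_swap hm.aemeasurable]
      refine (lintegral_mono fun x => (setLIntegral_le_lintegral _ _).trans
        (lintegral_comp_add_smul_le hg _ h)).trans_eq ?_
      rw [setLIntegral_const]
    · simp_rw [add_comm _ (t • _)]
      refine (lintegral_mono fun x => (setLIntegral_le_lintegral _ _).trans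
        (lintegral_comp_add_smul_le hg _ (by linarith))).trans_eq ?_
      rw [setLIntegral_const]
  rw [hswap]
  refine (setLIntegral_mono' measurableSet_Icc hslice).trans_eq ?_
  simp

lemma exists_contDiff_step : ∃ (ζ : ℝ → ℝ) (M : ℝ≥0), ContDiff ℝ (⊤ : ℕ∞) ζ ∧
    (∀ t, |t| ≤ 1 → ζ t = 0) ∧ (∀ t, 2 ≤ |t| → ζ t = 1) ∧ (∀ t, ‖deriv ζ t‖ₑ ≤ M) ∧
    ∀ t, deriv ζ t ≠ 0 → 1 < |t| ∧ |t| < 2 := by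
  let f : ContDiffBump (0 : ℝ) := ⟨1, 2, one_pos, one_lt_two⟩
  have hf : ContDiff ℝ (⊤ : ℕ∞) fun t => 1 - f t := contDiff_const.sub f.contDiff
  have h0 : ∀ t, |t| ≤ 1 → 1 - f t = 0 := fun t ht => by
    rw [f.one_of_mem_closedBall (by simpa using ht), sub_self]
  have h1 : ∀ t, 2 ≤ |t| → 1 - f t = 1 := fun t ht => by
    rw [f.zero_of_le_dist (by simpa using ht), sub_zero]
  have hd : ∀ t, deriv (fun t => 1 - f t) t ≠ 0 → 1 < |t| ∧ |t| < 2 := fun t ht => by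
    contrapose! ht
    by_cases h : |t| ≤ 1
    · refine IsLocalMin.deriv_eq_zero (Eventually.of_forall fun s => ?_)
      simp only [h0 t h]
      linarith [f.le_one (x := s)]
    · refine IsLocalMax.deriv_eq_zero (Eventually.of_forall fun s => ?_)
      simp only [h1 t (ht (not_le.1 h))]
      linarith [f.nonneg (x := s)]
  obtain ⟨M, hM⟩ := (isCompact_Icc (a := (-2 : ℝ)) (b := 2)).exists_bound_of_continuousOn
    (hf.continuous_deriv (by simp)).continuousOn
  refine ⟨fun t => 1 - f t, M.toNNReal, hf, h0, h1, fun t => ?_, hd⟩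
  by_cases ht : deriv (fun t => 1 - f t) t = 0
  · simp [ht]
  · rw [← ofReal_norm]
    exact ENNReal.ofReal_le_ofReal (hM t (abs_le.1 (hd t ht).2.le))

lemma lintegral_enorm_rpow_le_of_capacity (hΩ : IsOpen Ω) {μ ν : Measure (Evec n)}
    (hμ : ∀ᵐ x ∂μ, x ∈ Ω) (hν : ∀ᵐ x ∂ν, x ∈ Ω) {Q : Set (Evec n)} {p : ℝ} (hp : 0 < p)
    {C : ℝ≥0∞}
    (hcap : ∀ A, IsOpen A → A ⊆ Ω → ∀ u : Evec n → ℝ, ContDiffOn ℝ (⊤ : ℕ∞) u Ω →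
      (∀ x ∈ A, u x = 1) → (∀ x ∈ Q, u x = 0) → μ A ≤ C * ∫⁻ x, ‖fderiv ℝ u x‖ₑ ^ p ∂ν) :
    ∃ M : ℝ≥0, ∀ w : Evec n → ℝ, ContDiffOn ℝ (⊤ : ℕ∞) w Ω → (∀ x ∈ Q, w x = 0) →
      ∫⁻ x, ‖w x‖ₑ ^ p ∂μ ≤ M * C * ∫⁻ x, ‖fderiv ℝ w x‖ₑ ^ p ∂ν := by
  obtain ⟨ζ, M, hζ, hζ0, hζ1, hM, hsupp⟩ := exists_contDiff_step
  refine ⟨4 ^ p * M ^ p, fun w hw hwQ => ?_⟩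
  let A : ℤ → Set (Evec n) := fun k => {x ∈ Ω | (2 : ℝ) ^ (k + 1) < |w x|}
  have hAo : ∀ k, IsOpen (A k) := fun k =>
    hw.continuousOn.abs.isOpen_inter_preimage hΩ isOpen_Ioi
  have hpos : ∀ k : ℤ, (0 : ℝ) < 2 ^ k := fun k => zpow_pos two_pos k
  have hscale : ∀ (k : ℤ) (x : Evec n), |2 ^ (-k) * w x| = 2 ^ (-k) * |w x| := fun k x => by
    rw [abs_mul, abs_of_pos (hpos _)]
  have hμA : ∀ k, μ (A k) ≤ C * ∫⁻ x, ‖(2 : ℝ) ^ (-k)‖ₑ ^ p *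
      (‖deriv ζ (2 ^ (-k) * w x)‖ₑ ^ p * ‖fderiv ℝ w x‖ₑ ^ p) ∂ν := by
    intro k
    refine (hcap (A k) (hAo k) (fun x hx => hx.1) (fun x => ζ (2 ^ (-k) * w x))
      (hζ.comp_contDiffOn (contDiffOn_const.mul hw)) (fun x hx => hζ1 _ ?_)
      fun x hx => hζ0 _ (by simp [hwQ x hx])).trans ?_
    · rw [hscale]
      calc (2 : ℝ) = 2 ^ (-k) * 2 ^ (k + 1) := by rw [← zpow_add₀ two_ne_zero]; simp
        _ ≤ _ := mul_le_mul_of_nonneg_left hx.2.le (hpos _).le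
    · refine mul_le_mul_right (lintegral_mono_ae ?_) _
      filter_upwards [hν] with x hx
      have h1 : HasFDerivAt w (fderiv ℝ w x) x :=
        ((hw.contDiffAt (hΩ.mem_nhds hx)).differentiableAt (by simp)).hasFDerivAt
      have h2 : HasDerivAt ζ (deriv ζ (2 ^ (-k) * w x)) (2 ^ (-k) * w x) :=
        (hζ.differentiable (by simp) _).hasDerivAt
      have h3 : fderiv ℝ (fun x => ζ (2 ^ (-k) * w x)) x = _ :=
        (h2.comp_hasFDerivAt x (h1.const_mul (2 ^ (-k) : ℝ))).fderiv
      rw [h3, enorm_smul, enorm_smul, ENNReal.mul_rpow_of_nonneg _ _ hp.le,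
        ENNReal.mul_rpow_of_nonneg _ _ hp.le]
      exact (mul_left_comm _ _ _).le
  have hlow : ∫⁻ x, ‖w x‖ₑ ^ p ∂μ ≤
      ∑' k : ℤ, ENNReal.ofReal (2 ^ (k + 2)) ^ p * μ (A k) := by
    have : ∀ k : ℤ, ENNReal.ofReal (2 ^ (k + 2)) ^ p * μ (A k) =
        ∫⁻ x, (A k).indicator (fun _ => ENNReal.ofReal (2 ^ (k + 2)) ^ p) x ∂μ := fun k =>
      (lintegral_indicator_const (hAo k).measurableSet _).symm
    simp_rw [this]
    rw [← lintegral_tsum fun k => (measurable_const.indicator (hAo k).measurableSet).aemeasurable]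
    refine lintegral_mono_ae ?_
    filter_upwards [hμ] with x hx
    rcases eq_or_ne (w x) 0 with h0 | h0
    · simp [h0, hp]
    obtain ⟨k, hk1, hk2⟩ := exists_mem_Ioc_zpow (abs_pos.2 h0) (one_lt_two (α := ℝ))
    refine le_trans ?_ (ENNReal.le_tsum (k - 1))
    have hxA : x ∈ A (k - 1) := ⟨hx, by simpa using hk1⟩
    rw [indicator_of_mem hxA, Real.enorm_eq_ofReal_abs]
    rw [show k - 1 + 2 = k + 1 by ring]
    gcongr
  have hcoef : ∀ k : ℤ, ENNReal.ofReal (2 ^ (k + 2)) ^ p * ‖(2 : ℝ) ^ (-k)‖ₑ ^ p = 4 ^ p := by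
    intro k
    rw [← ENNReal.mul_rpow_of_nonneg _ _ hp.le, Real.enorm_eq_ofReal (hpos _).le,
      ← ENNReal.ofReal_mul (hpos _).le, ← zpow_add₀ two_ne_zero]
    norm_num
  have hwm : AEMeasurable w ν := by
    rw [← Measure.restrict_eq_self_of_ae_mem hν]
    exact hw.continuousOn.aemeasurable hΩ.measurableSet
  have hm : ∀ k : ℤ, AEMeasurable
      (fun x => ‖deriv ζ (2 ^ (-k) * w x)‖ₑ ^ p * ‖fderiv ℝ w x‖ₑ ^ p) ν := fun k =>
    (((measurable_deriv ζ).comp_aemeasurable (hwm.const_mul _)).enorm.pow_const p).mul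
      ((measurable_fderiv ℝ w).enorm.pow_const p).aemeasurable
  have hsum : ∀ x, ∑' k : ℤ, ‖deriv ζ (2 ^ (-k) * w x)‖ₑ ^ p ≤ (M : ℝ≥0∞) ^ p := by
    intro x
    by_cases h : ∃ k : ℤ, deriv ζ (2 ^ (-k) * w x) ≠ 0
    · have hk : ∀ k : ℤ, deriv ζ (2 ^ (-k) * w x) ≠ 0 →
          (2 : ℝ) ^ k < |w x| ∧ |w x| < 2 ^ (k + 1) := fun k hk => by
        have := hsupp _ hk
        rwa [hscale, zpow_neg, ← div_eq_inv_mul, one_lt_div (hpos k), div_lt_iff₀ (hpos k),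
          ← zpow_one_add₀ two_ne_zero, add_comm] at this
      obtain ⟨k, h⟩ := h
      rw [tsum_eq_single k]
      · exact ENNReal.rpow_le_rpow (hM _) hp.le
      · intro j hj
        by_contra h'
        have hj' : deriv ζ (2 ^ (-j) * w x) ≠ 0 := fun h0 => h' (by simp [-zpow_neg, h0, hp])
        have a1 := (zpow_lt_zpow_iff_right₀ (one_lt_two (α := ℝ))).1 ((hk j hj').1.trans (hk k h).2)
        have a2 := (zpow_lt_zpow_iff_right₀ (one_lt_two (α := ℝ))).1 ((hk k h).1.trans (hk j hj').2)
        omega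
    · push Not at h
      simp [-zpow_neg, h, hp]
  calc ∫⁻ x, ‖w x‖ₑ ^ p ∂μ
      ≤ ∑' k : ℤ, ENNReal.ofReal (2 ^ (k + 2)) ^ p * μ (A k) := hlow
    _ ≤ ∑' k : ℤ, C * 4 ^ p *
          ∫⁻ x, ‖deriv ζ (2 ^ (-k) * w x)‖ₑ ^ p * ‖fderiv ℝ w x‖ₑ ^ p ∂ν := by
        refine ENNReal.tsum_le_tsum fun k => (mul_le_mul_right (hμA k) _).trans_eq ?_
        rw [lintegral_const_mul'' _ (hm k), ← hcoef k]
        ring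
    _ = C * 4 ^ p * ∫⁻ x, (∑' k : ℤ, ‖deriv ζ (2 ^ (-k) * w x)‖ₑ ^ p) *
          ‖fderiv ℝ w x‖ₑ ^ p ∂ν := by
        rw [ENNReal.tsum_mul_left, ← lintegral_tsum hm]
        simp_rw [ENNReal.tsum_mul_right]
    _ ≤ C * 4 ^ p * ∫⁻ x, (M : ℝ≥0∞) ^ p * ‖fderiv ℝ w x‖ₑ ^ p ∂ν := by
        gcongr with x
        exact hsum x
    _ = _ := by
        rw [lintegral_const_mul _ ((measurable_fderiv ℝ w).enorm.pow_const p), ENNReal.coe_mul,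
          ENNReal.coe_rpow_of_nonneg _ hp.le, ENNReal.coe_rpow_of_nonneg _ hp.le]
        push_cast
        ring

lemma exists_weight_le_of_isCompact (hn : 2 ≤ n) (hΩ : IsBoundedDomain Ω) {K : Set (Evec n)}
    (hK : IsCompact K) (hKΩ : K ⊆ Ω) (a : ℝ) :
    ∃ M : ℝ≥0, ∀ x ∈ K, ENNReal.ofReal (bdist Ω x ^ a) ≤ M := by
  have hc : ContinuousOn (fun x => bdist Ω x ^ a) K :=
    (continuous_bdist Ω).continuousOn.rpow_const fun x hx => Or.inl (hΩ.bdist_pos hn (hKΩ hx)).ne'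
  obtain ⟨M, hM⟩ := hK.exists_bound_of_continuousOn hc
  exact ⟨M.toNNReal, fun x hx => ENNReal.ofReal_le_ofReal ((le_abs_self _).trans (hM x hx))⟩

lemma setLIntegral_weightMeasure {K : Set (Evec n)} (hK : MeasurableSet K) (hKΩ : K ⊆ Ω) (a : ℝ)
    (f : Evec n → ℝ≥0∞) :
    ∫⁻ x in K, f x ∂weightMeasure Ω a = ∫⁻ x in K, ENNReal.ofReal (bdist Ω x ^ a) * f x := by
  rw [weightMeasure, setLIntegral_withDensity_eq_setLIntegral_mul_non_measurable _
    (measurable_weight Ω a) f hK (ae_of_all _ fun _ => ENNReal.ofReal_lt_top),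
    Measure.restrict_restrict hK, inter_eq_left.2 hKΩ]
  rfl

lemma exists_setLIntegral_weightMeasure_le (hn : 2 ≤ n) (hΩ : IsBoundedDomain Ω)
    {K : Set (Evec n)} (hK : IsCompact K) (hKΩ : K ⊆ Ω) (a : ℝ) :
    ∃ M : ℝ≥0, ∀ f : Evec n → ℝ≥0∞,
      ∫⁻ x in K, f x ∂weightMeasure Ω a ≤ M * ∫⁻ x in K, f x := by
  obtain ⟨M, hM⟩ := exists_weight_le_of_isCompact hn hΩ hK hKΩ a
  refine ⟨M, fun f => ?_⟩
  rw [setLIntegral_weightMeasure hK.measurableSet hKΩ, ← lintegral_const_mul' _ _ ENNReal.coe_ne_top]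
  exact setLIntegral_mono' hK.measurableSet fun x hx => mul_le_mul_left (hM x hx) _

lemma exists_setLIntegral_le_weightMeasure (hn : 2 ≤ n) (hΩ : IsBoundedDomain Ω)
    {K : Set (Evec n)} (hK : IsCompact K) (hKΩ : K ⊆ Ω) (a : ℝ) :
    ∃ M : ℝ≥0, ∀ f : Evec n → ℝ≥0∞,
      ∫⁻ x in K, f x ≤ M * ∫⁻ x in K, f x ∂weightMeasure Ω a := by
  obtain ⟨M, hM⟩ := exists_weight_le_of_isCompact hn hΩ hK hKΩ (-a)
  refine ⟨M, fun f => ?_⟩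
  rw [setLIntegral_weightMeasure hK.measurableSet hKΩ, ← lintegral_const_mul' _ _ ENNReal.coe_ne_top]
  refine setLIntegral_mono' hK.measurableSet fun x hx => ?_
  have hx0 := hΩ.bdist_pos hn (hKΩ hx)
  calc f x = ENNReal.ofReal (bdist Ω x ^ (-a)) * (ENNReal.ofReal (bdist Ω x ^ a) * f x) := by
        rw [← mul_assoc, ← ENNReal.ofReal_mul (by positivity), ← Real.rpow_add hx0]
        simp
    _ ≤ _ := mul_le_mul_left (hM x hx) _

lemma exists_contDiff_cutoff (x₀ : Evec n) {R : ℝ} (hR : 0 < R) :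
    ∃ (φ : Evec n → ℝ) (L : ℝ≥0), ContDiff ℝ (⊤ : ℕ∞) φ ∧ (∀ x, ‖φ x‖ₑ ≤ 1) ∧
      (∀ x ∈ Metric.closedBall x₀ (R / 2), φ x = 0) ∧
      (∀ x ∉ Metric.closedBall x₀ R, φ x = 1 ∧ fderiv ℝ φ x = 0) ∧ ∀ x, ‖fderiv ℝ φ x‖ₑ ≤ L := by
  let f : ContDiffBump x₀ := ⟨R / 2, R, half_pos hR, half_lt_self hR⟩
  have hf : ContDiff ℝ (⊤ : ℕ∞) fun x => 1 - f x := contDiff_const.sub f.contDiff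
  have h1 : ∀ x ∉ Metric.closedBall x₀ R, 1 - f x = 1 := fun x hx => by
    rw [f.zero_of_le_dist (not_le.1 hx).le, sub_zero]
  have hd : ∀ x ∉ Metric.closedBall x₀ R, fderiv ℝ (fun x => 1 - f x) x = 0 := fun x hx => by
    refine IsLocalMax.fderiv_eq_zero (Eventually.of_forall fun s => ?_)
    simp only [h1 x hx]
    linarith [f.nonneg (x := s)]
  obtain ⟨L, hL⟩ := (isCompact_closedBall x₀ R).exists_bound_of_continuousOn
    (hf.continuous_fderiv (by simp)).continuousOn
  refine ⟨fun x => 1 - f x, L.toNNReal, hf, fun x => ?_, fun x hx => ?_,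
    fun x hx => ⟨h1 x hx, hd x hx⟩, fun x => ?_⟩
  · rw [Real.enorm_eq_ofReal (sub_nonneg.2 f.le_one), ENNReal.ofReal_le_one]
    linarith [f.nonneg (x := x)]
  · simp [f.one_of_mem_closedBall hx]
  · by_cases hx : x ∈ Metric.closedBall x₀ R
    · rw [← ofReal_norm]
      exact ENNReal.ofReal_le_ofReal (hL x hx)
    · simp [hd x hx]

lemma exists_isClosedCube_subset_closedBall (hn : 2 ≤ n) (x₀ : Evec n) {R : ℝ} (hR : 0 < R) :
    ∃ Q, IsClosedCube Q ∧ Q ⊆ Metric.closedBall x₀ R := by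
  have hn0 : (1 : ℝ) ≤ n := by exact_mod_cast (one_le_two.trans hn)
  have hr : 0 < R / n := by positivity
  refine ⟨_, ⟨x₀, R / n, hr, rfl⟩, fun x hx => ?_⟩
  rw [mem_closedBall_iff_norm, EuclideanSpace.norm_eq]
  refine Real.sqrt_le_iff.2 ⟨hR.le, ?_⟩
  calc ∑ i, ‖(x - x₀) i‖ ^ 2 ≤ ∑ _i : Fin n, (R / n) ^ 2 :=
        Finset.sum_le_sum fun i _ => pow_le_pow_left₀ (norm_nonneg _) (hx i) 2
    _ = R ^ 2 / n := by
        rw [Finset.sum_const, Finset.card_univ, Fintype.card_fin, nsmul_eq_mul]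
        field_simp
    _ ≤ R ^ 2 := div_le_self (sq_nonneg R) hn0

lemma IsClosedCube.volume_pos {Q : Set (Evec n)} (hQ : IsClosedCube Q) : 0 < volume Q := by
  obtain ⟨c, r, hr, rfl⟩ := hQ
  refine (Metric.measure_ball_pos volume c hr).trans_le (measure_mono fun x hx i => ?_)
  exact (PiLp.norm_apply_le (x - c) i).trans (mem_ball_iff_norm.1 hx).le

lemma IsClosedCube.isCompact {Q : Set (Evec n)} (hQ : IsClosedCube Q) (hΩ : IsBoundedDomain Ω)
    (hQΩ : Q ⊆ Ω) : IsCompact Q := by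
  refine Metric.isCompact_of_isClosed_isBounded ?_ (hΩ.2.2.subset hQΩ)
  obtain ⟨c, r, hr, rfl⟩ := hQ
  rw [Set.ofPred_forall]
  exact isClosed_iInter fun i => isClosed_le (by fun_prop) continuous_const

lemma measure_le_two_rpow_mul_lintegral {α : Type*} [MeasurableSpace α] {μ : Measure α} {S : Set α}
    (hS : MeasurableSet S) {v : α → ℝ} {p : ℝ} (hp : 0 < p) (hv : ∀ x ∈ S, 1 / 2 ≤ |v x|) :
    μ S ≤ 2 ^ p * ∫⁻ x, ‖v x‖ₑ ^ p ∂μ := by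
  rw [← lintegral_const_mul' _ _ (ENNReal.rpow_ne_top_of_nonneg hp.le ENNReal.ofNat_ne_top),
    ← setLIntegral_one]
  refine (setLIntegral_mono' hS fun x hx => ?_).trans (setLIntegral_le_lintegral _ _)
  rw [← ENNReal.mul_rpow_of_nonneg _ _ hp.le]
  refine ENNReal.one_le_rpow ?_ hp
  rw [show (2 : ℝ≥0∞) = ENNReal.ofReal 2 by simp, Real.enorm_eq_ofReal_abs,
    ← ENNReal.ofReal_mul zero_le_two, ENNReal.one_le_ofReal]
  linarith [hv x hx]

lemma lintegral_sub_average_rpow_le {α : Type*} [MeasurableSpace α] {μ : Measure α}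
    [IsFiniteMeasure μ] {u : α → ℝ} (hu : AEStronglyMeasurable u μ) {p : ℝ} (hp : 1 ≤ p) (c : ℝ) :
    ∫⁻ x, ‖u x - ⨍ y, u y ∂μ‖ₑ ^ p ∂μ ≤ 2 ^ p * ∫⁻ x, ‖u x - c‖ₑ ^ p ∂μ := by
  have hp0 : 0 < p := one_pos.trans_le hp
  rcases eq_zero_or_neZero μ with rfl | hμ
  · simp
  have h2 : (2 : ℝ≥0∞) ^ p ≠ 0 := by simp
  by_cases htop : ∫⁻ x, ‖u x - c‖ₑ ^ p ∂μ = ⊤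
  · rw [htop, ENNReal.mul_top h2]
    exact le_top
  have hm : AEStronglyMeasurable (fun x => u x - c) μ := hu.sub aestronglyMeasurable_const
  have hint : Integrable (fun x => u x - c) μ := by
    have : MemLp (fun x => u x - c) (ENNReal.ofReal p) μ := by
      refine ⟨hm, ?_⟩
      rw [eLpNorm_lt_top_iff_lintegral_rpow_enorm_lt_top (by simpa using hp0) ENNReal.ofReal_ne_top,
        ENNReal.toReal_ofReal hp0.le]
      exact lt_top_iff_ne_top.2 htop
    exact this.integrable (by simpa using hp)
  set ν : Measure α := (μ univ)⁻¹ • μ with hν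
  have hinv : (μ univ)⁻¹ ≠ ⊤ := by simpa using NeZero.ne μ
  have hνint : Integrable (fun x => u x - c) ν := hint.smul_measure hinv
  have hνprob : IsProbabilityMeasure ν := isProbabilityMeasureSMul
  have havg : ⨍ y, u y ∂μ - c = ∫ x, (u x - c) ∂ν := by
    have hu' : Integrable u ν :=
      (hνint.add (integrable_const c)).congr (ae_of_all _ fun x => by simp)
    rw [integral_sub hu' (integrable_const c)]
    simp [average, hν]
  have hle : ‖⨍ y, u y ∂μ - c‖ₑ ^ p ≤ (μ univ)⁻¹ * ∫⁻ x, ‖u x - c‖ₑ ^ p ∂μ := by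
    rw [havg, ← smul_eq_mul, ← lintegral_smul_measure]
    exact (ENNReal.rpow_le_rpow (enorm_integral_le_lintegral_enorm _) hp0.le).trans
      (rpow_lintegral_le_lintegral_rpow (hm.smul_measure _).enorm hp)
  calc ∫⁻ x, ‖u x - ⨍ y, u y ∂μ‖ₑ ^ p ∂μ
      ≤ ∫⁻ x, 2 ^ (p - 1) * (‖u x - c‖ₑ ^ p + ‖⨍ y, u y ∂μ - c‖ₑ ^ p) ∂μ := by
        refine lintegral_mono fun x => ?_
        refine le_trans (ENNReal.rpow_le_rpow ?_ hp0.le)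
          (ENNReal.rpow_add_le_mul_rpow_add_rpow _ _ hp)
        rw [← sub_sub_sub_cancel_right _ _ c]
        exact enorm_sub_le
    _ = 2 ^ (p - 1) * (∫⁻ x, ‖u x - c‖ₑ ^ p ∂μ + ‖⨍ y, u y ∂μ - c‖ₑ ^ p * μ univ) := by
        rw [lintegral_const_mul' _ _ (ENNReal.rpow_ne_top_of_nonneg (by linarith)
          ENNReal.ofNat_ne_top), lintegral_add_right _ measurable_const, lintegral_const]
    _ ≤ 2 ^ (p - 1) * (∫⁻ x, ‖u x - c‖ₑ ^ p ∂μ +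
          (μ univ)⁻¹ * (∫⁻ x, ‖u x - c‖ₑ ^ p ∂μ) * μ univ) := by gcongr
    _ = _ := by
        rw [mul_right_comm, ENNReal.inv_mul_cancel (by simpa using NeZero.ne μ)
          (measure_ne_top μ univ), one_mul, ← two_mul, ← mul_assoc]
        congr 1
        nth_rw 2 [← ENNReal.rpow_one 2]
        rw [← ENNReal.rpow_add _ _ two_ne_zero ENNReal.ofNat_ne_top, sub_add_cancel]

lemma exists_pos_le_ofReal {N : ℝ≥0∞} (hN : N ≠ ⊤) : ∃ C : ℝ, 0 < C ∧ N ≤ ENNReal.ofReal C :=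
  ⟨N.toReal + 1, by positivity, (ENNReal.le_ofReal_iff_toReal_le hN (by positivity)).2 (by simp)⟩

lemma enorm_zero_clm : ‖(0 : Evec n →L[ℝ] ℝ)‖ₑ = 0 := by
  rw [← ofReal_norm, norm_zero, ENNReal.ofReal_zero]

lemma enorm_add_le_clm (f g : Evec n →L[ℝ] ℝ) : ‖f + g‖ₑ ≤ ‖f‖ₑ + ‖g‖ₑ := by
  simp only [← ofReal_norm]
  rw [← ENNReal.ofReal_add (norm_nonneg _) (norm_nonneg _)]
  exact ENNReal.ofReal_le_ofReal (norm_add_le _ _)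

lemma weightMeasure_ne_top_and_exists_lintegral_sub_rpow_le (hn : 2 ≤ n)
    (hΩ : IsBoundedDomain Ω) {p a b : ℝ} (hp : 1 ≤ p)
    (hcap : ∀ Q : Set (Evec n), IsClosedCube Q → Q ⊆ Ω → ∃ C : ℝ≥0, ∀ A, IsOpen A → A ⊆ Ω →
      ∀ u : Evec n → ℝ, ContDiffOn ℝ (⊤ : ℕ∞) u Ω → (∀ x ∈ A, u x = 1) → (∀ x ∈ Q, u x = 0) →
        weightMeasure Ω a A ≤ C * ∫⁻ x, ‖fderiv ℝ u x‖ₑ ^ p ∂weightMeasure Ω b) :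
    weightMeasure Ω a univ ≠ ⊤ ∧ ∃ N : ℝ≥0, ∀ u : Evec n → ℝ, ContDiffOn ℝ (⊤ : ℕ∞) u Ω →
      ∃ c : ℝ, ∫⁻ x, ‖u x - c‖ₑ ^ p ∂weightMeasure Ω a ≤
        N * ∫⁻ x, ‖fderiv ℝ u x‖ₑ ^ p ∂weightMeasure Ω b := by
  have hp0 : 0 < p := one_pos.trans_le hp
  obtain ⟨x₀, hx₀⟩ := hΩ.2.1.nonempty
  obtain ⟨R, hR, hKΩ⟩ := Metric.nhds_basis_closedBall.mem_iff.1 (hΩ.1.mem_nhds hx₀)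
  obtain ⟨Q, hQ, hQsub⟩ := exists_isClosedCube_subset_closedBall hn x₀ (half_pos hR)
  obtain ⟨φ, L, hφ, hφ1, hφ0, hφK, hφL⟩ := exists_contDiff_cutoff x₀ hR
  have hφQ : ∀ x ∈ Q, φ x = 0 := fun x hx => hφ0 x (hQsub hx)
  set K := Metric.closedBall x₀ R with hKdef
  have hK : IsCompact K := isCompact_closedBall x₀ R
  have hQΩ : Q ⊆ Ω :=
    (hQsub.trans (Metric.closedBall_subset_closedBall (half_le_self hR.le))).trans hKΩ
  obtain ⟨C, hC⟩ := hcap Q hQ hQΩ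
  obtain ⟨M, hM⟩ := lintegral_enorm_rpow_le_of_capacity hΩ.1 (ae_mem_weightMeasure hΩ.1 a)
    (ae_mem_weightMeasure hΩ.1 b) hp0 hC
  obtain ⟨Ma, hMa⟩ := exists_setLIntegral_weightMeasure_le hn hΩ hK hKΩ a
  obtain ⟨Mb, hMb⟩ := exists_setLIntegral_weightMeasure_le hn hΩ hK hKΩ b
  obtain ⟨Mb', hMb'⟩ := exists_setLIntegral_le_weightMeasure hn hΩ hK hKΩ b
  have hKm : MeasurableSet K := hK.measurableSet
  have hfin : ∀ {s : ℝ} {m : ℝ≥0}, (∀ f : Evec n → ℝ≥0∞,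
      ∫⁻ x in K, f x ∂weightMeasure Ω s ≤ m * ∫⁻ x in K, f x) → weightMeasure Ω s K ≠ ⊤ := by
    intro s m h
    have := h 1
    simp only [Pi.one_apply, setLIntegral_one] at this
    exact ne_top_of_le_ne_top (ENNReal.mul_ne_top ENNReal.coe_ne_top hK.measure_ne_top) this
  constructor
  · have h1 : weightMeasure Ω a Kᶜ ≤ ∫⁻ x, ‖φ x‖ₑ ^ p ∂weightMeasure Ω a := by
      rw [← setLIntegral_one]
      refine (setLIntegral_mono' hKm.compl fun x hx => ?_).trans (setLIntegral_le_lintegral _ _)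
      simp [(hφK x hx).1]
    have h2 : ∫⁻ x, ‖fderiv ℝ φ x‖ₑ ^ p ∂weightMeasure Ω b ≤ L ^ p * weightMeasure Ω b K := by
      rw [← lintegral_indicator_const hKm]
      refine lintegral_mono fun x => ?_
      by_cases hx : x ∈ K
      · rw [indicator_of_mem hx]
        exact ENNReal.rpow_le_rpow (hφL x) hp0.le
      · rw [(hφK x hx).2, enorm_zero_clm, ENNReal.zero_rpow_of_pos hp0]
        exact zero_le
    have h3 : weightMeasure Ω a Kᶜ ≠ ⊤ := by
      refine ne_top_of_le_ne_top ?_ (h1.trans ((hM φ hφ.contDiffOn hφQ).trans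
        (mul_le_mul_right h2 _)))
      exact ENNReal.mul_ne_top (ENNReal.mul_ne_top ENNReal.coe_ne_top ENNReal.coe_ne_top)
        (ENNReal.mul_ne_top (ENNReal.rpow_ne_top_of_nonneg hp0.le ENNReal.coe_ne_top) (hfin hMb))
    rw [← measure_add_measure_compl hKm]
    exact ENNReal.add_ne_top.2 ⟨hfin hMa, h3⟩
  · set P : ℝ≥0∞ := ENNReal.ofReal (2 * R) ^ p * 2 ^ n with hP
    have hPtop : P ≠ ⊤ := ENNReal.mul_ne_top
      (ENNReal.rpow_ne_top_of_nonneg hp0.le ENNReal.ofReal_ne_top) (by simp)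
    set N : ℝ≥0∞ := M * C * (2 ^ (p - 1) * (1 + L ^ p * (Mb * (P * Mb')))) + Ma * (P * Mb') with hN
    have hNtop : N ≠ ⊤ := by
      have h2 : (2 : ℝ≥0∞) ^ (p - 1) ≠ ⊤ :=
        ENNReal.rpow_ne_top_of_nonneg (by linarith) ENNReal.ofNat_ne_top
      have h3 : (L : ℝ≥0∞) ^ p ≠ ⊤ := ENNReal.rpow_ne_top_of_nonneg hp0.le ENNReal.coe_ne_top
      finiteness
    refine ⟨N.toNNReal, fun u hu => ?_⟩
    rw [ENNReal.coe_toNNReal hNtop]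
    obtain ⟨c, hc⟩ := exists_lintegral_enorm_sub_rpow_le hΩ.1 (hu.of_le (by simp))
      (convex_closedBall x₀ R) hKm hKΩ hp (D := ENNReal.ofReal (2 * R)) (fun x hx y hy => by
        rw [← ofReal_norm, ← dist_eq_norm]
        exact ENNReal.ofReal_le_ofReal ((dist_triangle_right y x x₀).trans
          (by linarith [Metric.mem_closedBall.1 hx, Metric.mem_closedBall.1 hy])))
      (Metric.measure_closedBall_pos volume x₀ hR).ne' hK.measure_ne_top
    refine ⟨c, ?_⟩
    set E := ∫⁻ x, ‖fderiv ℝ u x‖ₑ ^ p ∂weightMeasure Ω b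
    have hcE : ∫⁻ x in K, ‖u x - c‖ₑ ^ p ≤ P * Mb' * E := by
      rw [hP, mul_assoc, mul_assoc]
      rw [← hKdef] at hc
      refine hc.trans ?_
      gcongr
      exact (hMb' _).trans (mul_le_mul_right (setLIntegral_le_lintegral _ _) _)
    set w : Evec n → ℝ := fun x => φ x * (u x - c) with hwdef
    have hw : ContDiffOn ℝ (⊤ : ℕ∞) w Ω := hφ.contDiffOn.mul (hu.sub contDiffOn_const)
    have hwE : ∫⁻ x, ‖fderiv ℝ w x‖ₑ ^ p ∂weightMeasure Ω b ≤
        2 ^ (p - 1) * (1 + L ^ p * (Mb * (P * Mb'))) * E := by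
      have hpt : ∀ x ∈ Ω, ‖fderiv ℝ w x‖ₑ ^ p ≤ 2 ^ (p - 1) * (‖fderiv ℝ u x‖ₑ ^ p +
          K.indicator (fun x => L ^ p * ‖u x - c‖ₑ ^ p) x) := by
        intro x hx
        have hux : HasFDerivAt (fun x => u x - c) (fderiv ℝ u x) x :=
          (((hu.contDiffAt (hΩ.1.mem_nhds hx)).differentiableAt (by simp)).hasFDerivAt).sub_const c
        have hφx : HasFDerivAt φ (fderiv ℝ φ x) x :=
          (hφ.differentiable (by simp) x).hasFDerivAt
        have hwx : fderiv ℝ w x = φ x • fderiv ℝ u x + (u x - c) • fderiv ℝ φ x :=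
          (hφx.mul hux).fderiv
        have hle : ‖fderiv ℝ w x‖ₑ ≤
            ‖fderiv ℝ u x‖ₑ + K.indicator (fun x => L * ‖u x - c‖ₑ) x := by
          rw [hwx]
          refine (enorm_add_le_clm _ _).trans (add_le_add ?_ ?_)
          · rw [enorm_smul]
            exact mul_le_of_le_one_left' (hφ1 x)
          · by_cases hxK : x ∈ K
            · rw [indicator_of_mem hxK, enorm_smul, mul_comm]
              gcongr
              exact hφL x
            · rw [(hφK x hxK).2, smul_zero, enorm_zero_clm]
              exact zero_le
        refine (ENNReal.rpow_le_rpow hle hp0.le).trans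
          ((ENNReal.rpow_add_le_mul_rpow_add_rpow _ _ hp).trans_eq ?_)
        congr 2
        by_cases hxK : x ∈ K
        · simp [hxK, ENNReal.mul_rpow_of_nonneg _ _ hp0.le]
        · simp [hxK, hp0]
      calc ∫⁻ x, ‖fderiv ℝ w x‖ₑ ^ p ∂weightMeasure Ω b
          ≤ ∫⁻ x, 2 ^ (p - 1) * (‖fderiv ℝ u x‖ₑ ^ p +
              K.indicator (fun x => L ^ p * ‖u x - c‖ₑ ^ p) x) ∂weightMeasure Ω b := by
            refine lintegral_mono_ae ?_
            filter_upwards [ae_mem_weightMeasure hΩ.1 b] with x hx using hpt x hx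
        _ = 2 ^ (p - 1) * (E + L ^ p * ∫⁻ x in K, ‖u x - c‖ₑ ^ p ∂weightMeasure Ω b) := by
            rw [lintegral_const_mul' _ _ (ENNReal.rpow_ne_top_of_nonneg (by linarith)
              ENNReal.ofNat_ne_top),
              lintegral_add_left ((measurable_fderiv ℝ u).enorm.pow_const p),
              lintegral_indicator hKm, lintegral_const_mul' _ _
              (ENNReal.rpow_ne_top_of_nonneg hp0.le ENNReal.coe_ne_top)]
        _ ≤ 2 ^ (p - 1) * (E + L ^ p * (Mb * (P * Mb' * E))) := by
            gcongr
            exact (hMb _).trans (mul_le_mul_right hcE _)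
        _ = _ := by ring
    have hum : AEMeasurable u (weightMeasure Ω a) :=
      (hu.continuousOn.aemeasurable hΩ.1.measurableSet).mono_ac (withDensity_absolutelyContinuous _ _)
    calc ∫⁻ x, ‖u x - c‖ₑ ^ p ∂weightMeasure Ω a
        ≤ ∫⁻ x, ‖w x‖ₑ ^ p + K.indicator (fun x => ‖u x - c‖ₑ ^ p) x ∂weightMeasure Ω a := by
          refine lintegral_mono fun x => ?_
          by_cases hxK : x ∈ K
          · simp [hxK]
          · simp [hxK, hwdef, (hφK x hxK).1]
      _ = ∫⁻ x, ‖w x‖ₑ ^ p ∂weightMeasure Ω a +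
            ∫⁻ x in K, ‖u x - c‖ₑ ^ p ∂weightMeasure Ω a := by
          rw [lintegral_add_right' _ (((hum.sub_const c).enorm.pow_const p).indicator hKm),
            lintegral_indicator hKm]
      _ ≤ M * C * (2 ^ (p - 1) * (1 + L ^ p * (Mb * (P * Mb'))) * E) + Ma * (P * Mb' * E) := by
          gcongr
          · exact (hM w hw fun x hx => by simp [hwdef, hφQ x hx]).trans (mul_le_mul_right hwE _)
          · exact (hMa _).trans (mul_le_mul_right hcE _)
      _ = N * E := by rw [hN]; ring

lemma weightMeasure_univ_ne_top_of_poincare {p a b : ℝ} (hp : 0 < p) {C : ℝ≥0∞}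
    (h : ∀ u : Evec n → ℝ, ContDiffOn ℝ (⊤ : ℕ∞) u Ω →
      ∫⁻ x, ‖u x - ⨍ y, u y ∂weightMeasure Ω a‖ₑ ^ p ∂weightMeasure Ω a ≤
        C * ∫⁻ x, ‖fderiv ℝ u x‖ₑ ^ p ∂weightMeasure Ω b) :
    weightMeasure Ω a univ ≠ ⊤ := by
  intro htop
  have h1 := h (fun _ => 1) contDiffOn_const
  have h2 : ⨍ _y : Evec n, (1 : ℝ) ∂weightMeasure Ω a = 0 := by
    simp [average_eq, Measure.real, htop]
  rw [h2] at h1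
  simp [hp, htop, enorm_zero_clm] at h1

lemma exists_weightMeasure_le_of_poincare (hn : 2 ≤ n) (hΩ : IsBoundedDomain Ω) {p a b : ℝ}
    (hp : 0 < p) {C : ℝ≥0∞} (hC : C ≠ ⊤)
    (h : ∀ u : Evec n → ℝ, ContDiffOn ℝ (⊤ : ℕ∞) u Ω →
      ∫⁻ x, ‖u x - ⨍ y, u y ∂weightMeasure Ω a‖ₑ ^ p ∂weightMeasure Ω a ≤
        C * ∫⁻ x, ‖fderiv ℝ u x‖ₑ ^ p ∂weightMeasure Ω b)
    {Q : Set (Evec n)} (hQ : IsClosedCube Q) (hQΩ : Q ⊆ Ω) :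
    ∃ N : ℝ≥0∞, N ≠ ⊤ ∧ ∀ A, MeasurableSet A →
      ∀ u : Evec n → ℝ, ContDiffOn ℝ (⊤ : ℕ∞) u Ω → (∀ x ∈ A, u x = 1) → (∀ x ∈ Q, u x = 0) →
        weightMeasure Ω a A ≤ N * ∫⁻ x, ‖fderiv ℝ u x‖ₑ ^ p ∂weightMeasure Ω b := by
  have hμtop := weightMeasure_univ_ne_top_of_poincare hp h
  have hQc := hQ.isCompact hΩ hQΩ
  have hQ0 : weightMeasure Ω a Q ≠ 0 := by
    obtain ⟨M, hM⟩ := exists_setLIntegral_le_weightMeasure hn hΩ hQc hQΩ a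
    intro h0
    have := hM 1
    simp only [Pi.one_apply, setLIntegral_one, h0, mul_zero, nonpos_iff_eq_zero] at this
    exact hQ.volume_pos.ne' this
  have hQtop : weightMeasure Ω a Q ≠ ⊤ := ne_top_of_le_ne_top hμtop (measure_mono (subset_univ _))
  have h2 : (2 : ℝ≥0∞) ^ p ≠ ⊤ := ENNReal.rpow_ne_top_of_nonneg hp.le ENNReal.ofNat_ne_top
  set q := weightMeasure Ω a univ / weightMeasure Ω a Q
  have hqtop : q ≠ ⊤ := ENNReal.div_ne_top hμtop hQ0
  refine ⟨(1 + q) * (2 ^ p * C), by finiteness, fun A hA u hu hu1 hu0 => ?_⟩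
  set m := ⨍ y, u y ∂weightMeasure Ω a
  have hS : ∀ S, MeasurableSet S → (∀ x ∈ S, 1 / 2 ≤ |u x - m|) → weightMeasure Ω a S ≤
      2 ^ p * C * ∫⁻ x, ‖fderiv ℝ u x‖ₑ ^ p ∂weightMeasure Ω b := fun S hS hSm => by
    rw [mul_assoc]
    exact (measure_le_two_rpow_mul_lintegral hS hp hSm).trans (mul_le_mul_right (h u hu) _)
  rw [mul_assoc, add_mul, one_mul]
  by_cases hm2 : 1 / 2 ≤ |m|
  · refine le_add_left ?_
    calc weightMeasure Ω a A ≤ weightMeasure Ω a univ := measure_mono (subset_univ _)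
      _ = q * weightMeasure Ω a Q := (ENNReal.div_mul_cancel hQ0 hQtop).symm
      _ ≤ _ := by
        gcongr
        exact hS Q hQc.measurableSet fun x hx => by simpa [hu0 x hx] using hm2
  · refine le_add_right (hS A hA fun x hx => ?_)
    rw [hu1 x hx]
    have := abs_lt.1 (not_le.1 hm2)
    exact le_abs.2 (Or.inl (by linarith))

end Capacity

/-- **Theorem 2.3 (Hajłasz–Koskela characterization).** On a bounded domain `Ω ⊆ ℝⁿ`,
`n ≥ 2`, `p ≥ 1`, `a, b ∈ ℝ`, the weighted Poincaré inequality for smooth functions is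
equivalent to the capacity-type condition: for an arbitrary cube `Q ⊂⊂ Ω` there is
`C(Q) > 0` with `∫_A ρ^a ≤ C ∫_Ω |∇u|^p ρ^b` for every admissible `A ⊆ Ω` disjoint from
`Q` and every smooth `u` with `u ≡ 1` on `A`, `u ≡ 0` on `Q`. -/
theorem poincare_iff_capacity {n : ℕ} (hn : 2 ≤ n) (Ω : Set (Evec n)) (p a b : ℝ)
    (hΩ : IsBoundedDomain Ω) (hp : 1 ≤ p) :
    (∃ C > 0, ∀ u : Evec n → ℝ, ContDiffOn ℝ (⊤ : ℕ∞) u Ω →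
        wIp Ω Ω p a (fun x => u x - wAvg Ω a u) ≤
          ENNReal.ofReal C * wIp Ω Ω p b (gradLen u)) ↔
    (∀ Q : Set (Evec n), IsClosedCube Q → Q ⊆ Ω →
      ∃ C > 0, ∀ A : Set (Evec n), IsAdmissible Ω A → A ∩ Q = ∅ →
        ∀ u : Evec n → ℝ, ContDiffOn ℝ (⊤ : ℕ∞) u Ω → (∀ x ∈ A, u x = 1) → (∀ x ∈ Q, u x = 0) →
          (∫⁻ x in A, ENNReal.ofReal (bdist Ω x ^ a)) ≤
            ENNReal.ofReal C * wIp Ω Ω p b (gradLen u)) := by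
  have hp0 : 0 < p := one_pos.trans_le hp
  simp only [wIp_gradLen_eq_lintegral_weightMeasure Ω hp0.le,
    wIp_eq_lintegral_weightMeasure Ω hp0.le, wAvg_eq_average]
  constructor
  · rintro ⟨C, -, hC⟩ Q hQ hQΩ
    obtain ⟨N, hN, h⟩ :=
      exists_weightMeasure_le_of_poincare hn hΩ hp0 ENNReal.ofReal_ne_top hC hQ hQΩ
    obtain ⟨C', hC', hNC⟩ := exists_pos_le_ofReal hN
    refine ⟨C', hC', fun A hA _ u hu hu1 hu0 => ?_⟩
    rw [← weightMeasure_apply hA.1.measurableSet hA.2.1]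
    exact (h A hA.1.measurableSet u hu hu1 hu0).trans (mul_le_mul_left hNC _)
  · intro h
    have hcap : ∀ Q : Set (Evec n), IsClosedCube Q → Q ⊆ Ω → ∃ C : ℝ≥0, ∀ A, IsOpen A → A ⊆ Ω →
        ∀ u : Evec n → ℝ, ContDiffOn ℝ (⊤ : ℕ∞) u Ω → (∀ x ∈ A, u x = 1) → (∀ x ∈ Q, u x = 0) →
          weightMeasure Ω a A ≤ C * ∫⁻ x, ‖fderiv ℝ u x‖ₑ ^ p ∂weightMeasure Ω b := by
      intro Q hQ hQΩ
      obtain ⟨C, -, hC⟩ := h Q hQ hQΩ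
      refine ⟨C.toNNReal, fun A hA hAΩ u hu hu1 hu0 => ?_⟩
      refine measure_le_of_forall_isAdmissible (weightMeasure_absolutelyContinuous Ω a) hA hAΩ
        fun B hB hBA => ?_
      rw [weightMeasure_apply hB.1.measurableSet hB.2.1]
      refine hC B hB (disjoint_iff_inter_eq_empty.1 (disjoint_left.2 fun x hxB hxQ => ?_)) u hu
        (fun x hx => hu1 x (hBA hx)) hu0
      exact one_ne_zero ((hu1 x (hBA hxB)).symm.trans (hu0 x hxQ))
    obtain ⟨htop, N, hN⟩ := weightMeasure_ne_top_and_exists_lintegral_sub_rpow_le hn hΩ hp hcap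
    have : IsFiniteMeasure (weightMeasure Ω a) := ⟨htop.lt_top⟩
    obtain ⟨C, hC, hNC⟩ := exists_pos_le_ofReal (N := 2 ^ p * N)
      (ENNReal.mul_ne_top (ENNReal.rpow_ne_top_of_nonneg hp0.le ENNReal.ofNat_ne_top)
        ENNReal.coe_ne_top)
    refine ⟨C, hC, fun u hu => ?_⟩
    obtain ⟨c, hc⟩ := hN u hu
    have hum : AEMeasurable u (weightMeasure Ω a) :=
      (hu.continuousOn.aemeasurable hΩ.1.measurableSet).mono_ac (withDensity_absolutelyContinuous _ _)
    refine (lintegral_sub_average_rpow_le hum.aestronglyMeasurable hp c).trans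
      ((mul_le_mul_right hc _).trans ?_)
    rw [← mul_assoc]
    exact mul_le_mul_left hNC _
end
end

section
/- Let s ≥ 1, p > 1, a ≥ 0 and b ∈ ℝ with n + a < s(n + b − 1) − p + 1 (here n = 2). Then there exists a bounded s-John domain Ω ⊂ ℝ² on which the weighted Korn inequality (K_{p,a,b−p}) fails; that is, there is no constant C > 0 such that ∫_Ω |Dv|^p ρ^a dx ≤ C { ∫_Ω |ε(v)|^p ρ^{b−p} dx + ∫_Ω |v|^p ρ^a dx } for all v ∈ W^{1,p}(Ω,ρ^a)². -/
open MeasureTheory Set Filter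
open scoped ENNReal NNReal Topology

noncomputable section

/-- An `s`-John domain: a bounded domain with a distinguished point `x₀` such that every
point can be joined to `x₀` by a curve, parametrized by arclength (here: `1`-Lipschitz),
along which the distance to the complement grows at least like `C t^s`. -/
def IsSJohn {n : ℕ} (Ω : Set (Evec n)) (s : ℝ) : Prop :=
  IsBoundedDomain Ω ∧ ∃ x₀ ∈ Ω, ∃ C > (0:ℝ), ∀ x ∈ Ω, ∃ l : ℝ, 0 ≤ l ∧ ∃ γ : ℝ → Evec n,
    γ 0 = x ∧ γ l = x₀ ∧ (∀ t ∈ Icc (0:ℝ) l, γ t ∈ Ω) ∧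
    (∀ t₁ ∈ Icc (0:ℝ) l, ∀ t₂ ∈ Icc (0:ℝ) l, dist (γ t₁) (γ t₂) ≤ |t₁ - t₂|) ∧
    ∀ t ∈ Icc (0:ℝ) l, C * t ^ s ≤ Metric.infDist (γ t) Ωᶜ

/-! ### Open rectangles -/

/-- The open rectangle `(a, b) × (c, d)` in the plane. -/
def openRect (a b c d : ℝ) : Set (Evec 2) :=
  {x | a < x 0 ∧ x 0 < b ∧ c < x 1 ∧ x 1 < d}

lemma isOpen_openRect (a b c d : ℝ) : IsOpen (openRect a b c d) := by
  have h0 : Continuous fun x : Evec 2 => x 0 := by fun_prop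
  have h1 : Continuous fun x : Evec 2 => x 1 := by fun_prop
  exact (isOpen_lt continuous_const h0).inter ((isOpen_lt h0 continuous_const).inter
    ((isOpen_lt continuous_const h1).inter (isOpen_lt h1 continuous_const)))

lemma convex_openRect (a b c d : ℝ) : Convex ℝ (openRect a b c d) := by
  have key : ∀ (u v l m α β : ℝ), 0 ≤ α → 0 ≤ β → α + β = 1 → l < u → l < v → u < m → v < m →
      l < α * u + β * v ∧ α * u + β * v < m := by
    intro u v l m α β hα hβ hαβ h1 h2 h3 h4
    have := convex_Ioo l m ⟨h1, h3⟩ ⟨h2, h4⟩ hα hβ hαβ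
    simpa using this
  rintro x ⟨hx1, hx2, hx3, hx4⟩ y ⟨hy1, hy2, hy3, hy4⟩ α β hα hβ hαβ
  have k0 := key _ _ _ _ α β hα hβ hαβ hx1 hy1 hx2 hy2
  have k1 := key _ _ _ _ α β hα hβ hαβ hx3 hy3 hx4 hy4
  refine ⟨?_, ?_, ?_, ?_⟩ <;> simp [k0, k1]

lemma abs_coord_sub_le_dist (x y : Evec 2) (i : Fin 2) : |x i - y i| ≤ dist x y := by
  rw [dist_eq_norm]
  simpa using PiLp.norm_apply_le (x - y) i

lemma dist_le_abs_add_abs (x y : Evec 2) : dist x y ≤ |x 0 - y 0| + |x 1 - y 1| := by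
  rw [EuclideanSpace.dist_eq, Fin.sum_univ_two, Real.dist_eq, Real.dist_eq]
  apply Real.sqrt_le_iff.2
  constructor
  · positivity
  · nlinarith [abs_nonneg (x 0 - y 0), abs_nonneg (x 1 - y 1)]

lemma norm_le_abs_add_abs (x : Evec 2) : ‖x‖ ≤ |x 0| + |x 1| := by
  simpa using dist_le_abs_add_abs x 0

lemma ball_subset_openRect {a b c d R : ℝ} {x : Evec 2} (h0 : a + R ≤ x 0) (h1 : x 0 + R ≤ b)
    (h2 : c + R ≤ x 1) (h3 : x 1 + R ≤ d) : Metric.ball x R ⊆ openRect a b c d := by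
  intro y hy
  have k0 := abs_lt.1 ((abs_coord_sub_le_dist y x 0).trans_lt (Metric.mem_ball.1 hy))
  have k1 := abs_lt.1 ((abs_coord_sub_le_dist y x 1).trans_lt (Metric.mem_ball.1 hy))
  exact ⟨by linarith, by linarith, by linarith, by linarith⟩

lemma setLIntegral_openRect (a b c d : ℝ) {f : ℝ → ℝ≥0∞} (hf : Measurable f) :
    ∫⁻ x in openRect a b c d, f (x 1) = ENNReal.ofReal (b - a) * ∫⁻ y in Ioo c d, f y := by
  have e := (volume_preserving_finTwoArrow ℝ).comp
    (PiLp.volume_preserving_ofLp (Fin 2))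
  have hpre : openRect a b c d =
      (fun x : Evec 2 => MeasurableEquiv.finTwoArrow (WithLp.ofLp x)) ⁻¹'
        (Ioo a b ×ˢ Ioo c d) := by
    ext x
    simp [openRect, and_assoc]
  have h2 := e.setLIntegral_comp_preimage (s := Ioo a b ×ˢ Ioo c d)
    (measurableSet_Ioo.prod measurableSet_Ioo) (f := fun z : ℝ × ℝ => f z.2)
    (hf.comp measurable_snd)
  have h3 : ∫⁻ x in openRect a b c d, f (x 1) =
      ∫⁻ z in Ioo a b ×ˢ Ioo c d, f z.2 := by
    rw [← h2, hpre]
    rfl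
  rw [h3, Measure.volume_eq_prod, ← Measure.prod_restrict]
  have h4 := lintegral_prod_mul (μ := (volume : Measure ℝ).restrict (Ioo a b))
    (ν := (volume : Measure ℝ).restrict (Ioo c d)) (f := fun _ => (1 : ℝ≥0∞)) (g := f)
    aemeasurable_const hf.aemeasurable
  simpa using h4

lemma volume_openRect (a b c d : ℝ) :
    volume (openRect a b c d) = ENNReal.ofReal (b - a) * ENNReal.ofReal (d - c) := by
  simpa using setLIntegral_openRect a b c d (f := fun _ => 1) measurable_const

lemma setLIntegral_rpow_Ioo {b L : ℝ} (hb : -1 < b) (hL : 0 ≤ L) (d : ℝ) :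
    ∫⁻ y in Ioo d (d + L), ENNReal.ofReal ((y - d) ^ b)
      = ENNReal.ofReal (L ^ (b + 1) / (b + 1)) := by
  have h1 : ∫⁻ y in Ioo d (d + L), ENNReal.ofReal ((y - d) ^ b)
      = ∫⁻ y in Ioo 0 L, ENNReal.ofReal (y ^ b) := by
    have e := (measurePreserving_sub_right (volume : Measure ℝ) d).setLIntegral_comp_preimage
      (s := Ioo 0 L) measurableSet_Ioo (f := fun y => ENNReal.ofReal (y ^ b)) (by fun_prop)
    rw [← e]
    congr 2
    ext y
    simp [add_comm]
  rw [h1, setLIntegral_congr Ioo_ae_eq_Ioc, ← ofReal_integral_eq_lintegral_ofReal,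
    ← intervalIntegral.integral_of_le hL, integral_rpow (Or.inl hb), Real.zero_rpow (by linarith),
    sub_zero]
  · exact (intervalIntegrable_iff_integrableOn_Ioc_of_le hL).1
      (intervalIntegral.intervalIntegrable_rpow' hb)
  · filter_upwards [ae_restrict_mem measurableSet_Ioc] with y hy
    exact Real.rpow_nonneg hy.1.le _

/-! ### Distance to the boundary -/

lemma exists_mem_segment_frontier {n : ℕ} {Ω : Set (Evec n)} {x z : Evec n} (hx : x ∈ Ω)
    (hz : z ∉ Ω) : ∃ y ∈ segment ℝ x z, y ∈ frontier Ω := by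
  by_contra! h
  have hxi : x ∈ interior Ω := by
    by_contra hn
    exact h x (left_mem_segment ℝ x z) ⟨subset_closure hx, hn⟩
  have hzc : z ∈ (closure Ω)ᶜ := fun hn =>
    h z (right_mem_segment ℝ x z) ⟨hn, fun hi => hz (interior_subset hi)⟩
  obtain ⟨y, -, hy1, hy2⟩ := (convex_segment x z).isPreconnected (interior Ω) (closure Ω)ᶜ
    isOpen_interior isClosed_closure.isOpen_compl
    (fun y hy => by
      by_contra hn
      simp only [mem_union, mem_compl_iff, not_or, not_not] at hn
      exact h y hy ⟨hn.2, hn.1⟩)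
    ⟨x, left_mem_segment ℝ x z, hxi⟩ ⟨z, right_mem_segment ℝ x z, hzc⟩
  exact hy2 (subset_closure (interior_subset hy1))

lemma bdist_le_dist {n : ℕ} {Ω : Set (Evec n)} {x z : Evec n} (hx : x ∈ Ω) (hz : z ∉ Ω) :
    bdist Ω x ≤ dist x z := by
  obtain ⟨y, hy, hyf⟩ := exists_mem_segment_frontier hx hz
  refine (Metric.infDist_le_dist_of_mem hyf).trans ?_
  have := dist_add_dist_of_mem_segment hy
  linarith [dist_nonneg (x := y) (y := z)]

lemma le_bdist {n : ℕ} {Ω : Set (Evec n)} (hΩ : IsOpen Ω) {x z : Evec n} {R : ℝ}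
    (hx : x ∈ Ω) (hz : z ∉ Ω) (h : Metric.ball x R ⊆ Ω) : R ≤ bdist Ω x := by
  obtain ⟨y, -, hyf⟩ := exists_mem_segment_frontier hx hz
  refine (Metric.le_infDist ⟨y, hyf⟩).2 fun q hq => ?_
  by_contra! hlt
  rw [hΩ.frontier_eq] at hq
  exact hq.2 (h (by rwa [Metric.mem_ball, dist_comm]))

/-! ### Curves with clearance -/

/-- There is a `1`-Lipschitz curve `γ : [0, l] → Ω` from `x` to `z` such that the ball of radius
`φ t` around `γ t` stays in `Ω`. -/
def HasCurve {n : ℕ} (Ω : Set (Evec n)) (x z : Evec n) (l : ℝ) (φ : ℝ → ℝ) : Prop :=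
  ∃ γ : ℝ → Evec n, γ 0 = x ∧ γ l = z ∧ (∀ t ∈ Icc (0:ℝ) l, γ t ∈ Ω) ∧
    (∀ t₁ ∈ Icc (0:ℝ) l, ∀ t₂ ∈ Icc (0:ℝ) l, dist (γ t₁) (γ t₂) ≤ |t₁ - t₂|) ∧
    ∀ t ∈ Icc (0:ℝ) l, Metric.ball (γ t) (φ t) ⊆ Ω

lemma HasCurve.mono {n : ℕ} {Ω : Set (Evec n)} {x z : Evec n} {l : ℝ} {φ ψ : ℝ → ℝ}
    (h : HasCurve Ω x z l φ) (hψ : ∀ t ∈ Icc (0:ℝ) l, ψ t ≤ φ t) : HasCurve Ω x z l ψ := by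
  obtain ⟨γ, h0, h1, h2, h3, h4⟩ := h
  exact ⟨γ, h0, h1, h2, h3, fun t ht => (Metric.ball_subset_ball (hψ t ht)).trans (h4 t ht)⟩

lemma HasCurve.trans {n : ℕ} {Ω : Set (Evec n)} {x y z : Evec n} {l₁ l₂ : ℝ} {φ₁ φ₂ : ℝ → ℝ}
    (hl₁ : 0 ≤ l₁) (hl₂ : 0 ≤ l₂) (h₁ : HasCurve Ω x y l₁ φ₁) (h₂ : HasCurve Ω y z l₂ φ₂) :
    HasCurve Ω x z (l₁ + l₂) (fun t => if t ≤ l₁ then φ₁ t else φ₂ (t - l₁)) := by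
  obtain ⟨γ, hx, hy, hΩ, hL, hB⟩ := h₁
  obtain ⟨δ, hy', hz, hΩ', hL', hB'⟩ := h₂
  have mixed : ∀ u ∈ Icc (0:ℝ) l₁, ∀ v, l₁ < v → v ≤ l₁ + l₂ →
      dist (γ u) (δ (v - l₁)) ≤ v - u := by
    intro u hu v hv hv'
    have a1 := hL u hu l₁ ⟨hl₁, le_rfl⟩
    have a2 := hL' 0 ⟨le_rfl, hl₂⟩ (v - l₁) ⟨by linarith, by linarith⟩
    rw [hy, abs_sub_comm, abs_of_nonneg (by linarith [hu.2])] at a1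
    rw [hy', abs_sub_comm, abs_of_nonneg (by linarith)] at a2
    linarith [dist_triangle (γ u) y (δ (v - l₁))]
  refine ⟨fun t => if t ≤ l₁ then γ t else δ (t - l₁), by simp [hl₁, hx], ?_, ?_, ?_, ?_⟩
  · by_cases h : l₂ = 0
    · subst h
      simp [hy, ← hz, hy']
    · have : ¬ l₁ + l₂ ≤ l₁ := by
        have := lt_of_le_of_ne hl₂ (Ne.symm h)
        linarith
      simp [this, hz]
  · rintro t ⟨ht0, ht1⟩
    dsimp only
    split_ifs with h
    · exact hΩ t ⟨ht0, h⟩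
    · exact hΩ' _ ⟨by linarith, by linarith⟩
  · rintro t ⟨ht0, ht1⟩ u ⟨hu0, hu1⟩
    dsimp only
    split_ifs with h h' h'
    · exact hL t ⟨ht0, h⟩ u ⟨hu0, h'⟩
    · refine (mixed t ⟨ht0, h⟩ u (not_le.1 h') hu1).trans ?_
      rw [abs_sub_comm]
      exact le_abs_self _
    · rw [dist_comm]
      exact (mixed u ⟨hu0, h'⟩ t (not_le.1 h) ht1).trans (le_abs_self _)
    · refine (hL' (t - l₁) ⟨by linarith, by linarith⟩ (u - l₁)
        ⟨by linarith, by linarith⟩).trans_eq ?_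
      congr 1
      ring
  · rintro t ⟨ht0, ht1⟩
    dsimp only
    split_ifs with h
    · exact hB t ⟨ht0, h⟩
    · exact hB' _ ⟨by linarith, by linarith⟩

lemma ball_lineMap_subset {n : ℕ} {U : Set (Evec n)} (hU : Convex ℝ U) {x m : Evec n} {R c : ℝ}
    (hx : x ∈ U) (hm : Metric.ball m R ⊆ U) (hc0 : 0 ≤ c) (hc1 : c ≤ 1) :
    Metric.ball (AffineMap.lineMap x m c) (c * R) ⊆ U := by
  intro y hy
  rcases hc0.eq_or_lt with rfl | hc
  · simp at hy
  have hq : m + c⁻¹ • (y - AffineMap.lineMap x m c) ∈ U := by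
    apply hm
    rw [Metric.mem_ball, dist_eq_norm, add_sub_cancel_left, norm_smul, norm_inv, Real.norm_eq_abs,
      abs_of_pos hc, inv_mul_lt_iff₀ hc, ← dist_eq_norm]
    exact hy
  have := hU hx hq (sub_nonneg.2 hc1) hc0 (by ring)
  convert this using 1
  rw [smul_add, smul_smul, mul_inv_cancel₀ hc.ne', one_smul, AffineMap.lineMap_apply_module]
  abel

lemma dist_lineMap_div_le {n : ℕ} (x m : Evec n) (t u : ℝ) :
    dist (AffineMap.lineMap x m (t / dist x m) : Evec n) (AffineMap.lineMap x m (u / dist x m))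
      ≤ |t - u| := by
  rw [dist_lineMap_lineMap, Real.dist_eq, ← sub_div, abs_div, abs_of_nonneg dist_nonneg]
  rw [div_mul_eq_mul_div]
  exact div_le_of_le_mul₀ dist_nonneg (abs_nonneg _) le_rfl

lemma lineMap_div_dist {n : ℕ} (x m : Evec n) :
    (AffineMap.lineMap x m (dist x m / dist x m) : Evec n) = m := by
  rcases eq_or_ne x m with rfl | h
  · simp
  · rw [div_self (dist_ne_zero.2 h), AffineMap.lineMap_apply_one]

lemma hasCurve_of_convex {n : ℕ} {Ω U : Set (Evec n)} (hUΩ : U ⊆ Ω) (hU : Convex ℝ U)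
    {x m : Evec n} {R K : ℝ} (hR : 0 < R) (hx : x ∈ U) (hm : Metric.ball m R ⊆ U)
    (hK : 0 < K) (hL : dist x m ≤ K * R) :
    HasCurve Ω x m (dist x m) (fun t => t / K) := by
  have hc : ∀ t ∈ Icc (0:ℝ) (dist x m), 0 ≤ t / dist x m ∧ t / dist x m ≤ 1 := fun t ht =>
    ⟨div_nonneg ht.1 dist_nonneg, div_le_one_of_le₀ ht.2 dist_nonneg⟩
  refine ⟨fun t => AffineMap.lineMap x m (t / dist x m), by simp, lineMap_div_dist x m,
    fun t ht => hUΩ ?_, fun t _ u _ => dist_lineMap_div_le x m t u, fun t ht => ?_⟩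
  · exact hU.lineMap_mem hx (hm (Metric.mem_ball_self hR)) (hc t ht)
  · refine (Metric.ball_subset_ball ?_).trans
      ((ball_lineMap_subset hU hx hm (hc t ht).1 (hc t ht).2).trans hUΩ)
    rcases (dist_nonneg (x := x) (y := m)).eq_or_lt with h | h
    · have ht0 : t = 0 := le_antisymm (ht.2.trans_eq h.symm) ht.1
      simp [ht0]
    · rw [div_mul_eq_mul_div, div_le_div_iff₀ hK h]
      nlinarith [ht.1]

lemma hasCurve_of_segment {n : ℕ} {Ω : Set (Evec n)} {x m : Evec n} {R : ℝ} (hR : 0 < R)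
    (h : ∀ y ∈ segment ℝ x m, Metric.ball y R ⊆ Ω) :
    HasCurve Ω x m (dist x m) (fun _ => R) := by
  have hc : ∀ t ∈ Icc (0:ℝ) (dist x m),
      (AffineMap.lineMap x m (t / dist x m) : Evec n) ∈ segment ℝ x m := fun t ht => by
    rw [segment_eq_image_lineMap]
    exact ⟨_, ⟨div_nonneg ht.1 dist_nonneg, div_le_one_of_le₀ ht.2 dist_nonneg⟩, rfl⟩
  exact ⟨fun t => AffineMap.lineMap x m (t / dist x m), by simp, lineMap_div_dist x m,
    fun t ht => h _ (hc t ht) (Metric.mem_ball_self hR), fun t _ u _ => dist_lineMap_div_le x m t u,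
    fun t ht => h _ (hc t ht)⟩

lemma HasCurve.max_of_ball {n : ℕ} {Ω : Set (Evec n)} {x z : Evec n} {l R : ℝ} (hl : 0 ≤ l)
    (hR : Metric.ball x R ⊆ Ω) (h : HasCurve Ω x z l (fun t => t / 2)) :
    HasCurve Ω x z l (fun t => max (R / 4) (t / 2)) := by
  obtain ⟨γ, h0, h1, h2, h3, h4⟩ := h
  refine ⟨γ, h0, h1, h2, h3, fun t ht => ?_⟩
  dsimp only
  rcases le_total (R / 4) (t / 2) with h | h
  · rw [max_eq_right h]
    exact h4 t ht
  · rw [max_eq_left h]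
    refine (Metric.ball_subset_ball' ?_).trans hR
    have := h3 t ht 0 ⟨le_rfl, hl⟩
    rw [h0, sub_zero, abs_of_nonneg ht.1] at this
    linarith [ht.1]

lemma isSJohn_of_hasCurve {n : ℕ} [NeZero n] {Ω : Set (Evec n)} {s C : ℝ} {x₀ : Evec n}
    (hΩ : IsOpen Ω) (hb : Bornology.IsBounded Ω) (hx₀ : x₀ ∈ Ω) (hC : 0 < C)
    (h : ∀ x ∈ Ω, ∃ l, 0 ≤ l ∧ HasCurve Ω x x₀ l (fun t => C * t ^ s)) : IsSJohn Ω s := by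
  have hne : Ωᶜ.Nonempty := by
    rw [nonempty_compl]
    rintro rfl
    exact NormedSpace.unbounded_univ ℝ (Evec n) hb
  refine ⟨⟨hΩ, ⟨⟨x₀, hx₀⟩, isPreconnected_of_forall x₀ fun x hx => ?_⟩, hb⟩, x₀, hx₀, C, hC,
    fun x hx => ?_⟩
  · obtain ⟨l, hl, γ, h0, h1, h2, h3, -⟩ := h x hx
    have hcont : ContinuousOn γ (Icc 0 l) :=
      (LipschitzOnWith.of_dist_le_mul (K := 1) fun t ht u hu => by
        simpa [Real.dist_eq] using h3 t ht u hu).continuousOn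
    exact ⟨γ '' Icc 0 l, image_subset_iff.2 h2, ⟨l, ⟨hl, le_rfl⟩, h1⟩, ⟨0, ⟨le_rfl, hl⟩, h0⟩,
      isPreconnected_Icc.image γ hcont⟩
  · obtain ⟨l, hl, γ, h0, h1, h2, h3, h4⟩ := h x hx
    refine ⟨l, hl, γ, h0, h1, h2, h3, fun t ht => (Metric.le_infDist hne).2 fun y hy => ?_⟩
    by_contra! hlt
    exact hy (h4 t ht (by rwa [Metric.mem_ball, dist_comm]))

/-! ### The domain -/

/-- The size `2⁻ⁱ` of the `i`-th room. -/
def roomSize (i : ℕ) : ℝ := (1 / 2) ^ i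

/-- The width `rᵢˢ` of the `i`-th corridor. -/
def doorSize (s : ℝ) (i : ℕ) : ℝ := roomSize i ^ s

/-- The number of cells of the `i`-th corridor. -/
def cellCount (s : ℝ) (i : ℕ) : ℕ := ⌈roomSize i / doorSize s i⌉₊

/-- The `k`-th cell of the `i`-th corridor. -/
def cell (s : ℝ) (i k : ℕ) : Set (Evec 2) :=
  openRect (10 * roomSize i - 3 * doorSize s i) (10 * roomSize i + 3 * doorSize s i)
    (4 * k * doorSize s i) (4 * (k + 1) * doorSize s i)

/-- The door below the `k`-th cell of the `i`-th corridor. -/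
def door (s : ℝ) (i k : ℕ) : Set (Evec 2) :=
  openRect (10 * roomSize i - doorSize s i) (10 * roomSize i + doorSize s i)
    ((4 * k - 1) * doorSize s i) ((4 * k + 1) * doorSize s i)

/-- The `i`-th room. -/
def room (s : ℝ) (i : ℕ) : Set (Evec 2) :=
  openRect (10 * roomSize i - 3 * roomSize i) (10 * roomSize i + 3 * roomSize i)
    (4 * cellCount s i * doorSize s i) (4 * cellCount s i * doorSize s i + 6 * roomSize i)

/-- The `i`-th corridor, made of cells joined by doors, together with the room at its end. -/
def tower (s : ℝ) (i : ℕ) : Set (Evec 2) :=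
  {x | (∃ k < cellCount s i, x ∈ cell s i k) ∨ (∃ k ≤ cellCount s i, x ∈ door s i k) ∨
    x ∈ room s i}

/-- The central square, to which all the corridors are attached. -/
def hall : Set (Evec 2) := openRect (-20) 20 (-40) 0

/-- A rooms-and-corridors domain, whose corridors are chains of cells joined by doors. -/
def towerDomain (s : ℝ) : Set (Evec 2) := {x | x ∈ hall ∨ ∃ i, x ∈ tower s i}

lemma roomSize_pos (i : ℕ) : 0 < roomSize i := by unfold roomSize; positivity

lemma roomSize_le_one (i : ℕ) : roomSize i ≤ 1 := pow_le_one₀ (by norm_num) (by norm_num)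

lemma roomSize_le_half {i j : ℕ} (h : i < j) : roomSize j ≤ roomSize i / 2 := by
  have : roomSize (i + 1) = roomSize i / 2 := by
    unfold roomSize
    rw [pow_succ]
    ring
  rw [← this]
  exact pow_le_pow_of_le_one (by norm_num) (by norm_num) h

lemma tendsto_roomSize : Tendsto roomSize atTop (𝓝 0) :=
  tendsto_pow_atTop_nhds_zero_of_lt_one (by norm_num) (by norm_num)

section

variable {s : ℝ}

lemma doorSize_pos (s : ℝ) (i : ℕ) : 0 < doorSize s i := Real.rpow_pos_of_pos (roomSize_pos i) s

lemma doorSize_le_roomSize (hs : 1 ≤ s) (i : ℕ) : doorSize s i ≤ roomSize i := by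
  have := Real.rpow_le_rpow_of_exponent_ge (roomSize_pos i) (roomSize_le_one i) hs
  rwa [Real.rpow_one] at this

lemma roomSize_le_cellCount_mul (s : ℝ) (i : ℕ) :
    roomSize i ≤ cellCount s i * doorSize s i :=
  (div_le_iff₀ (doorSize_pos s i)).1 (Nat.le_ceil _)

lemma cellCount_mul_le (hs : 1 ≤ s) (i : ℕ) :
    cellCount s i * doorSize s i ≤ 2 * roomSize i := by
  have hw := doorSize_pos s i
  have h1 : (cellCount s i : ℝ) < roomSize i / doorSize s i + 1 :=
    Nat.ceil_lt_add_one (div_nonneg (roomSize_pos i).le hw.le)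
  have h2 := mul_le_mul_of_nonneg_right h1.le hw.le
  rw [add_mul, div_mul_cancel₀ _ hw.ne'] at h2
  linarith [doorSize_le_roomSize hs i]

lemma one_le_cellCount (s : ℝ) (i : ℕ) : 1 ≤ cellCount s i :=
  Nat.ceil_pos.2 (div_pos (roomSize_pos i) (doorSize_pos s i))

lemma index_mul_le (hs : 1 ≤ s) {i k : ℕ} (hk : k ≤ cellCount s i) :
    (k : ℝ) * doorSize s i ≤ 2 * roomSize i := by
  refine le_trans ?_ (cellCount_mul_le hs i)
  have : (k : ℝ) ≤ cellCount s i := by exact_mod_cast hk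
  exact mul_le_mul_of_nonneg_right this (doorSize_pos s i).le

lemma isOpen_towerDomain (s : ℝ) : IsOpen (towerDomain s) := by
  have h : ∀ i, IsOpen (tower s i) := fun i => by
    have e : tower s i = (⋃ k, ⋃ (_ : k < cellCount s i), cell s i k) ∪
        ((⋃ k, ⋃ (_ : k ≤ cellCount s i), door s i k) ∪ room s i) := by
      ext x
      simp [tower]
    rw [e]
    exact (isOpen_iUnion fun k => isOpen_iUnion fun _ => isOpen_openRect _ _ _ _).union
      ((isOpen_iUnion fun k => isOpen_iUnion fun _ => isOpen_openRect _ _ _ _).union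
        (isOpen_openRect _ _ _ _))
  have e : towerDomain s = hall ∪ ⋃ i, tower s i := by
    ext x
    simp [towerDomain]
  rw [e]
  exact (isOpen_openRect _ _ _ _).union (isOpen_iUnion h)

lemma hall_subset (s : ℝ) : hall ⊆ towerDomain s := fun _ h => Or.inl h

lemma cell_subset {i k : ℕ} (hk : k < cellCount s i) : cell s i k ⊆ towerDomain s :=
  fun _ h => Or.inr ⟨i, Or.inl ⟨k, hk, h⟩⟩

lemma door_subset {i k : ℕ} (hk : k ≤ cellCount s i) : door s i k ⊆ towerDomain s :=
  fun _ h => Or.inr ⟨i, Or.inr (Or.inl ⟨k, hk, h⟩)⟩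

lemma room_subset (s : ℝ) (i : ℕ) : room s i ⊆ towerDomain s :=
  fun _ h => Or.inr ⟨i, Or.inr (Or.inr h)⟩

/-- Each point of a tower lies in a rectangle contained in the domain, and in which it is close to
a point of the centre line of the tower. -/
lemma exists_centre_of_mem_tower (hs : 1 ≤ s) {i : ℕ} {x : Evec 2} (hx : x ∈ tower s i) :
    ∃ a b c d h R : ℝ, openRect a b c d ⊆ towerDomain s ∧ x ∈ openRect a b c d ∧ 0 < R ∧
      R ≤ 3 * roomSize i ∧ a + R ≤ 10 * roomSize i ∧ 10 * roomSize i + R ≤ b ∧ c + R ≤ h ∧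
      h + R ≤ d ∧ b - 10 * roomSize i ≤ 3 / 2 * R ∧ 10 * roomSize i - a ≤ 3 / 2 * R ∧
      d - h ≤ R ∧ h - c ≤ R ∧ 0 ≤ h ∧
      h ≤ 4 * cellCount s i * doorSize s i + 3 * roomSize i := by
  have hr := roomSize_pos i
  have hw := doorSize_pos s i
  have hwr := doorSize_le_roomSize hs i
  have hkN : ∀ k ≤ cellCount s i, (k : ℝ) * doorSize s i ≤ cellCount s i * doorSize s i := by
    intro k hk
    gcongr
  rcases hx with ⟨k, hk, hx⟩ | ⟨k, hk, hx⟩ | hx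
  · have hk' := hkN k hk.le
    have hk0 : (0:ℝ) ≤ k * doorSize s i := by positivity
    exact ⟨_, _, _, _, (4 * k + 2) * doorSize s i, 2 * doorSize s i, cell_subset hk, hx,
      by linarith, by linarith, by linarith, by linarith, by linarith, by linarith, by linarith,
      by linarith, by linarith, by linarith, by linarith, by linarith⟩
  · have hk' := hkN k hk
    have hk0 : (0:ℝ) ≤ k * doorSize s i := by positivity
    exact ⟨_, _, _, _, (4 * k) * doorSize s i, doorSize s i, door_subset hk, hx,
      by linarith, by linarith, by linarith, by linarith, by linarith, by linarith, by linarith,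
      by linarith, by linarith, by linarith, by linarith, by linarith⟩
  · have hk0 : (0:ℝ) ≤ cellCount s i * doorSize s i := by positivity
    exact ⟨_, _, _, _, 4 * cellCount s i * doorSize s i + 3 * roomSize i, 3 * roomSize i,
      room_subset s i, hx,
      by linarith, by linarith, by linarith, by linarith, by linarith, by linarith, by linarith,
      by linarith, by linarith, by linarith, by linarith, by linarith⟩

/-- The centre line of a tower stays away from the complement of the domain. -/
lemma ball_centre_line_subset {i : ℕ} {x : Evec 2} (hs : 1 ≤ s) (h0 : x 0 = 10 * roomSize i)
    (h1 : -(doorSize s i / 2) ≤ x 1)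
    (h2 : x 1 ≤ 4 * cellCount s i * doorSize s i + 3 * roomSize i) :
    Metric.ball x (doorSize s i / 2) ⊆ towerDomain s := by
  have hr := roomSize_pos i
  have hw := doorSize_pos s i
  have hwr := doorSize_le_roomSize hs i
  have hN := roomSize_le_cellCount_mul s i
  rcases lt_or_ge (x 1) ((4 * cellCount s i + 1 / 2) * doorSize s i) with h | h
  · set k : ℕ := ⌊(x 1 / doorSize s i + 1 / 2) / 4⌋₊ with hkdef
    have hnn : 0 ≤ (x 1 / doorSize s i + 1 / 2) / 4 := by
      have : -(1 / 2) ≤ x 1 / doorSize s i := by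
        rw [le_div_iff₀ hw]
        linarith
      linarith
    have k1 : (k : ℝ) ≤ (x 1 / doorSize s i + 1 / 2) / 4 := Nat.floor_le hnn
    have k2 : (x 1 / doorSize s i + 1 / 2) / 4 < k + 1 := Nat.lt_floor_add_one _
    have e : x 1 / doorSize s i * doorSize s i = x 1 := div_mul_cancel₀ _ hw.ne'
    set t := x 1 / doorSize s i with ht
    rw [← e] at h h1 h2
    have h' : t < 4 * cellCount s i + 1 / 2 := lt_of_mul_lt_mul_right h hw.le
    rcases le_or_gt t (4 * k + 1 / 2) with h3 | h3
    · refine Subset.trans ?_ (door_subset (s := s) (i := i) (k := k) ?_)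
      · apply ball_subset_openRect
        · linarith
        · linarith
        · rw [← e]
          nlinarith
        · rw [← e]
          nlinarith
      · have : (k : ℝ) < cellCount s i + 1 := by linarith
        exact Nat.lt_succ_iff.1 (by exact_mod_cast this)
    · refine Subset.trans ?_ (cell_subset (s := s) (i := i) (k := k) ?_)
      · apply ball_subset_openRect
        · linarith
        · linarith
        · rw [← e]
          nlinarith
        · rw [← e]
          nlinarith
      · have : (k : ℝ) < cellCount s i := by linarith
        exact_mod_cast this
  · refine Subset.trans ?_ (room_subset s i)
    apply ball_subset_openRect
    · linarith
    · linarith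
    · linarith
    · linarith

lemma rpow_le_mul_self {K t : ℝ} (hs : 1 ≤ s) (hK : 1 ≤ K) (ht0 : 0 ≤ t) (htK : t ≤ K) :
    t ^ s ≤ K ^ s * t := by
  have hK0 : 0 < K := by linarith
  have h1 : (t / K) ^ s ≤ t / K := by
    have := Real.rpow_le_rpow_of_exponent_ge_of_imp (x := t / K) (by positivity)
      (div_le_one_of_le₀ htK hK0.le) hs (fun _ h => by linarith)
    rwa [Real.rpow_one] at this
  rw [Real.div_rpow ht0 hK0.le, div_le_iff₀ (by positivity)] at h1
  have h2 : t / K ≤ t := div_le_self ht0 hK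
  have h3 : 0 < K ^ s := by positivity
  nlinarith

lemma dist_le_of_mem_hall {x : Evec 2} (hx : x ∈ hall) : dist x !₂[0, -20] ≤ 40 := by
  obtain ⟨h0, h1, h2, h3⟩ := hx
  refine (dist_le_abs_add_abs _ _).trans ?_
  have k0 : |x 0 - 0| ≤ 20 := abs_le.2 ⟨by linarith, by linarith⟩
  have k1 : |x 1 - -20| ≤ 20 := abs_le.2 ⟨by linarith, by linarith⟩
  simp only [Matrix.cons_val_zero, Matrix.cons_val_one]
  linarith

lemma hasCurve_hall {x : Evec 2} (hx : x ∈ hall) :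
    HasCurve (towerDomain s) x !₂[0, -20] (dist x !₂[0, -20]) (fun t => t / 2) := by
  refine hasCurve_of_convex (hall_subset s) (convex_openRect _ _ _ _) (R := 20) (by norm_num) hx
    ?_ (by norm_num) ?_
  · apply ball_subset_openRect <;> norm_num
  · linarith [dist_le_of_mem_hall hx]

lemma isSJohn_towerDomain (hs : 1 ≤ s) : IsSJohn (towerDomain s) s := by
  have hK : (0:ℝ) < 100 ^ s := by positivity
  have hx₀ : (!₂[0, -20] : Evec 2) ∈ hall := by
    refine ⟨?_, ?_, ?_, ?_⟩ <;> norm_num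
  have hlin : ∀ t : ℝ, 0 ≤ t → t ≤ 100 → 1 / (8 * 100 ^ s) * t ^ s ≤ t / 8 := by
    intro t ht0 ht1
    have := rpow_le_mul_self hs (by norm_num) ht0 ht1
    rw [div_mul_eq_mul_div, one_mul, div_le_div_iff₀ (by positivity) (by norm_num)]
    linarith
  have hpow : ∀ i (t : ℝ), 0 ≤ t → t ≤ 100 * roomSize i →
      1 / (8 * 100 ^ s) * t ^ s ≤ doorSize s i / 8 := by
    intro i t ht0 ht1
    have := Real.rpow_le_rpow ht0 ht1 (by linarith : 0 ≤ s)
    rw [Real.mul_rpow (by norm_num) (roomSize_pos i).le] at this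
    rw [div_mul_eq_mul_div, one_mul, div_le_div_iff₀ (by positivity) (by norm_num)]
    unfold doorSize
    linarith
  refine isSJohn_of_hasCurve (C := 1 / (8 * 100 ^ s)) (isOpen_towerDomain s) ?_
    (hall_subset s hx₀) (by positivity) fun x hx => ?_
  · have hsub : towerDomain s ⊆ openRect (-40) 40 (-40) 40 := by
      rintro x (⟨h0, h1, h2, h3⟩ | ⟨i, hi⟩)
      · exact ⟨by linarith, by linarith, by linarith, by linarith⟩
      · obtain ⟨a, b, c, d, h, R, -, ⟨h0, h1, h2, h3⟩, k⟩ := exists_centre_of_mem_tower hs hi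
        have := roomSize_pos i
        have := roomSize_le_one i
        have := cellCount_mul_le hs i
        exact ⟨by linarith, by linarith, by linarith, by linarith⟩
    refine (Metric.isBounded_iff_subset_closedBall (0 : Evec 2)).2 ⟨80, fun x hx => ?_⟩
    obtain ⟨h0, h1, h2, h3⟩ := hsub hx
    rw [mem_closedBall_zero_iff]
    have k0 : |x 0| ≤ 40 := abs_le.2 ⟨by linarith, by linarith⟩
    have k1 : |x 1| ≤ 40 := abs_le.2 ⟨by linarith, by linarith⟩
    linarith [norm_le_abs_add_abs x]
  · rcases hx with hx | ⟨i, hi⟩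
    · refine ⟨_, dist_nonneg, (hasCurve_hall hx).mono fun t ht => ?_⟩
      have := hlin t ht.1 (by linarith [ht.2, dist_le_of_mem_hall hx])
      linarith [ht.1]
    · obtain ⟨a, b, c, d, h, R, hsub, hx, hR, hRr, k1, k2, k3, k4, k5, k6, k7, k8, k9, k10⟩ :=
        exists_centre_of_mem_tower hs hi
      have hr := roomSize_pos i
      have hr1 := roomSize_le_one i
      have hw := doorSize_pos s i
      have hwr := doorSize_le_roomSize hs i
      have hN := cellCount_mul_le hs i
      set m : Evec 2 := !₂[10 * roomSize i, h] with hm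
      set q : Evec 2 := !₂[10 * roomSize i, -(doorSize s i / 2)] with hq
      have m0 : m 0 = 10 * roomSize i := by simp [hm]
      have m1 : m 1 = h := by simp [hm]
      have q0 : q 0 = 10 * roomSize i := by simp [hq]
      have q1 : q 1 = -(doorSize s i / 2) := by simp [hq]
      have hqhall : q ∈ hall := by
        refine ⟨?_, ?_, ?_, ?_⟩
        · rw [q0]
          linarith
        · rw [q0]
          linarith
        · rw [q1]
          linarith
        · rw [q1]
          linarith
      have hxm : dist x m ≤ 5 / 2 * R := by
        refine (dist_le_abs_add_abs _ _).trans ?_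
        obtain ⟨h0, h1, h2, h3⟩ := hx
        have k0 : |x 0 - m 0| ≤ 3 / 2 * R := abs_le.2 ⟨by linarith, by linarith⟩
        have k1 : |x 1 - m 1| ≤ R := abs_le.2 ⟨by linarith, by linarith⟩
        linarith
      have hmq : dist m q ≤ 12 * roomSize i := by
        refine (dist_le_abs_add_abs _ _).trans ?_
        rw [m0, q0, m1, q1, sub_self, abs_zero, abs_of_nonneg (by linarith)]
        linarith
      have c1 := hasCurve_of_convex (K := 5 / 2) hsub (convex_openRect _ _ _ _) hR hx
        (ball_subset_openRect (x := m) (by linarith) (by linarith) (by linarith) (by linarith))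
        (by norm_num) hxm
      have c2 : HasCurve (towerDomain s) m q (dist m q) (fun _ => doorSize s i / 2) := by
        refine hasCurve_of_segment (by linarith) fun y hy => ?_
        obtain ⟨α, β, hα, hβ, hαβ, rfl⟩ := hy
        have y1 : (α • m + β • q) 1 = α * h - β * (doorSize s i / 2) := by
          simp [m1, q1]
          ring
        apply ball_centre_line_subset hs
        · simp only [PiLp.add_apply, PiLp.smul_apply, m0, q0, smul_eq_mul]
          rw [← add_mul, hαβ, one_mul]
        · rw [y1]
          nlinarith
        · rw [y1]
          nlinarith
      have c3 := (hasCurve_hall (s := s) hqhall).max_of_ball dist_nonneg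
        (ball_centre_line_subset hs q0 (by rw [q1]) (by rw [q1]; linarith))
      have hq40 := dist_le_of_mem_hall hqhall
      refine ⟨_, by positivity, ((c1.trans dist_nonneg dist_nonneg c2).trans (by positivity)
        dist_nonneg c3).mono fun t ht => ?_⟩
      split_ifs with h1 h2
      · have := hlin t ht.1 (by linarith)
        linarith [ht.1]
      · have := hpow i t ht.1 (by linarith)
        linarith
      · rcases le_total t (100 * roomSize i) with h3 | h3
        · refine le_trans ?_ (le_max_left _ _)
          have := hpow i t ht.1 h3
          linarith
        · refine le_trans ?_ (le_max_right _ _)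
          have := hlin t ht.1 (by linarith [ht.2])
          linarith

lemma eq_of_mem_strips {i j : ℕ} {z : ℝ} (hi : |z - 10 * roomSize i| ≤ 3 * roomSize i)
    (hj : |z - 10 * roomSize j| ≤ 3 * roomSize j) : i = j := by
  obtain ⟨a1, a2⟩ := abs_le.1 hi
  obtain ⟨b1, b2⟩ := abs_le.1 hj
  rcases lt_trichotomy i j with h | h | h
  · linarith [roomSize_le_half h, roomSize_pos i]
  · exact h
  · linarith [roomSize_le_half h, roomSize_pos j]

lemma abs_sub_lt_of_mem_tower (hs : 1 ≤ s) {i : ℕ} {x : Evec 2} (hx : x ∈ tower s i) :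
    |x 0 - 10 * roomSize i| < 3 * roomSize i := by
  have hwr := doorSize_le_roomSize hs i
  have hr := roomSize_pos i
  rcases hx with ⟨k, hk, h0, h1, -⟩ | ⟨k, hk, h0, h1, -⟩ | ⟨h0, h1, -⟩ <;>
  exact abs_lt.2 ⟨by linarith, by linarith⟩

lemma lt_of_mem_tower (hs : 1 ≤ s) {i : ℕ} {x : Evec 2} (hx : x ∈ tower s i) :
    x 1 < 15 * roomSize i := by
  have hwr := doorSize_le_roomSize hs i
  have hr := roomSize_pos i
  have hN := cellCount_mul_le hs i
  rcases hx with ⟨k, hk, -, -, -, h⟩ | ⟨k, hk, -, -, -, h⟩ | ⟨-, -, -, h⟩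
  · linarith [index_mul_le hs hk.le]
  · linarith [index_mul_le hs hk]
  · linarith

lemma abs_sub_lt_of_mem_tower_of_eq {i k : ℕ} (hk : k < cellCount s i) {x : Evec 2}
    (hx : x ∈ tower s i) (hxk : x 1 = 4 * k * doorSize s i) :
    |x 0 - 10 * roomSize i| < doorSize s i := by
  have hw := doorSize_pos s i
  rcases hx with ⟨m, hm, -, -, h2, h3⟩ | ⟨m, hm, h0, h1, -⟩ | ⟨-, -, h2, -⟩
  · rw [hxk] at h2 h3
    have h2' : (4 * m : ℝ) < 4 * k := lt_of_mul_lt_mul_right h2 hw.le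
    have h3' : (4 * k : ℝ) < 4 * (m + 1) := lt_of_mul_lt_mul_right h3 hw.le
    norm_cast at h2' h3'
    omega
  · exact abs_lt.2 ⟨by linarith, by linarith⟩
  · rw [hxk] at h2
    have h2' : (4 * cellCount s i : ℝ) < 4 * k := lt_of_mul_lt_mul_right h2 hw.le
    norm_cast at h2'
    omega

lemma mem_towerDomain_cases (hs : 1 ≤ s) (i : ℕ) {x : Evec 2} (hx : x ∈ towerDomain s) :
    x 1 < 0 ∨ 3 * roomSize i < |x 0 - 10 * roomSize i| ∨ x ∈ tower s i := by
  rcases hx with hx | ⟨j, hj⟩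
  · exact Or.inl hx.2.2.2
  · rcases lt_or_ge (3 * roomSize i) |x 0 - 10 * roomSize i| with h | h
    · exact Or.inr (Or.inl h)
    · rw [eq_of_mem_strips h (abs_sub_lt_of_mem_tower hs hj).le]
      exact Or.inr (Or.inr hj)

lemma notMem_towerDomain (hs : 1 ≤ s) {i : ℕ} {z : Evec 2} (h1 : 0 ≤ z 1)
    (h0 : |z 0 - 10 * roomSize i| ≤ 3 * roomSize i) (hz : z ∉ tower s i) :
    z ∉ towerDomain s := fun h => by
  rcases mem_towerDomain_cases hs i h with h | h | h
  · linarith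
  · linarith
  · exact hz h

end

/-! ### A vector field rotating one side of a door -/

lemma differentiableAt_and_pder {n : ℕ} {v : Evec n → Evec n} {x : Evec n}
    {L : Fin n → Evec n →L[ℝ] ℝ} (h : ∀ i, HasFDerivAt (fun y => v y i) (L i) x) :
    DifferentiableAt ℝ v x ∧ ∀ i j, pder v i j x = L i (EuclideanSpace.single j 1) := by
  have hd : DifferentiableAt ℝ v x :=
    differentiableAt_euclidean.2 fun i => (h i).differentiableAt
  refine ⟨hd, fun i j => ?_⟩
  have e := ((EuclideanSpace.proj i : Evec n →L[ℝ] ℝ).hasFDerivAt.comp x hd.hasFDerivAt).unique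
    (h i)
  rw [← e]
  rfl

/-- A smooth cutoff function on the line, equal to `1` on `[-1, 1]` and vanishing outside of
`(-2, 2)`. -/
def cut : ContDiffBump (0 : ℝ) := ⟨1, 2, by norm_num, by norm_num⟩

/-- The identity function cut off outside of `(-2, 2)`. -/
def cutId (u : ℝ) : ℝ := u * cut u

lemma cut_eq_one {t : ℝ} (h : |t| ≤ 1) : cut t = 1 :=
  cut.one_of_mem_closedBall (by simpa [cut] using h)

lemma cut_eq_zero {t : ℝ} (h : 2 ≤ |t|) : cut t = 0 :=
  cut.zero_of_le_dist (by simpa [cut] using h)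

lemma contDiff_cutId : ContDiff ℝ 2 cutId := contDiff_id.mul cut.contDiff

lemma eventually_abs_lt {t a : ℝ} (h : |t| < a) : ∀ᶠ y in 𝓝 t, |y| < a :=
  continuous_abs.continuousAt.eventually_lt continuousAt_const h

lemma eventually_lt_abs {t a : ℝ} (h : a < |t|) : ∀ᶠ y in 𝓝 t, a < |y| :=
  continuousAt_const.eventually_lt continuous_abs.continuousAt h

lemma deriv_cut_of_lt {t : ℝ} (h : |t| < 1) : deriv cut t = 0 := by
  have : cut =ᶠ[𝓝 t] fun _ => 1 := (eventually_abs_lt h).mono fun y hy => cut_eq_one hy.le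
  simp [this.deriv_eq]

lemma deriv_cut_of_gt {t : ℝ} (h : 2 < |t|) : deriv cut t = 0 := by
  have : cut =ᶠ[𝓝 t] fun _ => 0 := (eventually_lt_abs h).mono fun y hy => cut_eq_zero hy.le
  simp [this.deriv_eq]

lemma cutId_eq_self {u : ℝ} (h : |u| ≤ 1) : cutId u = u := by simp [cutId, cut_eq_one h]

lemma cutId_eq_zero {u : ℝ} (h : 2 ≤ |u|) : cutId u = 0 := by simp [cutId, cut_eq_zero h]

lemma deriv_cutId_of_lt {u : ℝ} (h : |u| < 1) : deriv cutId u = 1 := by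
  have : cutId =ᶠ[𝓝 u] id := (eventually_abs_lt h).mono fun y hy => cutId_eq_self hy.le
  simp [this.deriv_eq]

lemma deriv_cutId_of_gt {u : ℝ} (h : 2 < |u|) : deriv cutId u = 0 := by
  have : cutId =ᶠ[𝓝 u] fun _ => 0 := (eventually_lt_abs h).mono fun y hy => cutId_eq_zero hy.le
  simp [this.deriv_eq]

lemma deriv_deriv_cutId_of_lt {u : ℝ} (h : |u| < 1) : deriv (deriv cutId) u = 0 := by
  have : deriv cutId =ᶠ[𝓝 u] fun _ => 1 :=
    (eventually_abs_lt h).mono fun y hy => deriv_cutId_of_lt hy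
  simp [this.deriv_eq]

lemma deriv_deriv_cutId_of_gt {u : ℝ} (h : 2 < |u|) : deriv (deriv cutId) u = 0 := by
  have : deriv cutId =ᶠ[𝓝 u] fun _ => 0 :=
    (eventually_lt_abs h).mono fun y hy => deriv_cutId_of_gt hy
  simp [this.deriv_eq]

lemma contDiff_deriv_cutId : ContDiff ℝ 1 (deriv cutId) :=
  ((contDiff_succ_iff_deriv (n := 1)).1 (contDiff_cutId.of_le (by norm_num))).2.2

/-- A common bound for the cutoff functions and their derivatives. -/
lemma exists_cut_bound : ∃ B : ℝ, 1 ≤ B ∧ ∀ t, |cut t| ≤ B ∧ |deriv cut t| ≤ B ∧ |cutId t| ≤ B ∧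
    |deriv cutId t| ≤ B ∧ |deriv (deriv cutId) t| ≤ B := by
  have hc : HasCompactSupport cut := cut.hasCompactSupport
  have hG : HasCompactSupport cutId := hc.mul_left
  have cc : ContDiff ℝ 1 cut := cut.contDiff
  obtain ⟨B₁, h₁⟩ := cc.continuous.bounded_above_of_compact_support hc
  obtain ⟨B₂, h₂⟩ := (cc.continuous_deriv le_rfl).bounded_above_of_compact_support hc.deriv
  obtain ⟨B₃, h₃⟩ := contDiff_cutId.continuous.bounded_above_of_compact_support hG
  obtain ⟨B₄, h₄⟩ := contDiff_deriv_cutId.continuous.bounded_above_of_compact_support hG.deriv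
  obtain ⟨B₅, h₅⟩ := (contDiff_deriv_cutId.continuous_deriv
    le_rfl).bounded_above_of_compact_support hG.deriv.deriv
  simp only [Real.norm_eq_abs] at h₁ h₂ h₃ h₄ h₅
  have n₁ := (abs_nonneg _).trans (h₁ 0)
  have n₂ := (abs_nonneg _).trans (h₂ 0)
  have n₃ := (abs_nonneg _).trans (h₃ 0)
  have n₄ := (abs_nonneg _).trans (h₄ 0)
  have n₅ := (abs_nonneg _).trans (h₅ 0)
  refine ⟨1 + B₁ + B₂ + B₃ + B₄ + B₅, by linarith, fun t => ⟨?_, ?_, ?_, ?_, ?_⟩⟩ <;>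
  linarith [h₁ t, h₂ t, h₃ t, h₄ t, h₅ t]

/-- The field which vanishes below the line `x₁ = d`, is the infinitesimal rotation about `(c, d)`
well above that line, and bends along the parts of that line outside of the door
`|x₀ - c| < w`. -/
def hinge (c d w : ℝ) (x : Evec 2) : Evec 2 :=
  if d < x 1 then
    w • !₂[-((x 1 - d) / w) + (x 1 - d) / w * cut ((x 1 - d) / w) * deriv cutId ((x 0 - c) / w),
      (x 0 - c) / w - cut ((x 1 - d) / w) * cutId ((x 0 - c) / w)]
  else 0

section

variable {c d w : ℝ} {x : Evec 2}

lemma hinge_eq_zero_below (hx : x 1 < d) : hinge c d w =ᶠ[𝓝 x] fun _ => 0 := by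
  have h1 : Continuous fun x : Evec 2 => x 1 := by fun_prop
  filter_upwards [h1.continuousAt.eventually_lt continuousAt_const hx] with y hy
  simp [hinge, not_lt.2 hy.le]

lemma hinge_eq_zero_door (hw : 0 < w) (h0 : |x 0 - c| < w) (h1 : |x 1 - d| < w) :
    hinge c d w =ᶠ[𝓝 x] fun _ => 0 := by
  have k0 : Continuous fun x : Evec 2 => |x 0 - c| := by fun_prop
  have k1 : Continuous fun x : Evec 2 => |x 1 - d| := by fun_prop
  filter_upwards [k0.continuousAt.eventually_lt continuousAt_const h0,
    k1.continuousAt.eventually_lt continuousAt_const h1] with y hy0 hy1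
  have e0 : |(y 0 - c) / w| < 1 := by
    rwa [abs_div, abs_of_pos hw, div_lt_one hw]
  have e1 : |(y 1 - d) / w| < 1 := by
    rwa [abs_div, abs_of_pos hw, div_lt_one hw]
  unfold hinge
  split_ifs
  · rw [deriv_cutId_of_lt e0, cut_eq_one e1.le, cutId_eq_self e0.le]
    ext i
    fin_cases i <;> simp
  · rfl

lemma pder_eq_zero_of_eventuallyEq {n : ℕ} {v : Evec n → Evec n} {x : Evec n}
    (h : v =ᶠ[𝓝 x] fun _ => 0) : DifferentiableAt ℝ v x ∧ ∀ i j, pder v i j x = 0 := by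
  refine ⟨(differentiableAt_const _).congr_of_eventuallyEq h, fun i j => ?_⟩
  rw [pder, h.fderiv_eq]
  simp

lemma hinge_deriv_above (hw : 0 < w) (hx : d < x 1) :
    DifferentiableAt ℝ (hinge c d w) x ∧
      pder (hinge c d w) 0 0 x = (x 1 - d) / w * cut ((x 1 - d) / w) *
        deriv (deriv cutId) ((x 0 - c) / w) ∧
      pder (hinge c d w) 0 1 x = -1 + (cut ((x 1 - d) / w) +
        (x 1 - d) / w * deriv cut ((x 1 - d) / w)) * deriv cutId ((x 0 - c) / w) ∧
      pder (hinge c d w) 1 0 x = 1 - cut ((x 1 - d) / w) * deriv cutId ((x 0 - c) / w) ∧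
      pder (hinge c d w) 1 1 x = -(deriv cut ((x 1 - d) / w) * cutId ((x 0 - c) / w)) := by
  have hev : ∀ᶠ y in 𝓝 x, d < y 1 := by
    have h1 : Continuous fun x : Evec 2 => x 1 := by fun_prop
    exact continuousAt_const.eventually_lt h1.continuousAt hx
  set u := (x 0 - c) / w with hu
  set t := (x 1 - d) / w with ht
  have hU : HasFDerivAt (fun y : Evec 2 => (y 0 - c) / w)
      (w⁻¹ • (EuclideanSpace.proj 0 : Evec 2 →L[ℝ] ℝ)) x := by
    simpa [div_eq_inv_mul] using
      (((EuclideanSpace.proj 0 : Evec 2 →L[ℝ] ℝ).hasFDerivAt (x := x)).sub_const c).const_mul w⁻¹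
  have hT : HasFDerivAt (fun y : Evec 2 => (y 1 - d) / w)
      (w⁻¹ • (EuclideanSpace.proj 1 : Evec 2 →L[ℝ] ℝ)) x := by
    simpa [div_eq_inv_mul] using
      (((EuclideanSpace.proj 1 : Evec 2 →L[ℝ] ℝ).hasFDerivAt (x := x)).sub_const d).const_mul w⁻¹
  have cc : ContDiff ℝ 1 cut := cut.contDiff
  have dcut : HasDerivAt cut (deriv cut t) t := (cc.differentiable (by norm_num) t).hasDerivAt
  have dG : HasDerivAt cutId (deriv cutId u) u :=
    (contDiff_cutId.differentiable (by norm_num) u).hasDerivAt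
  have dG' : HasDerivAt (deriv cutId) (deriv (deriv cutId) u) u :=
    (contDiff_deriv_cutId.differentiable (by norm_num) u).hasDerivAt
  have c1 := dcut.comp_hasFDerivAt x hT
  have g1 := dG.comp_hasFDerivAt x hU
  have g2 := dG'.comp_hasFDerivAt x hU
  have v0 := (hT.neg.add ((hT.mul c1).mul g2)).const_mul w
  have v1 := (hU.sub (c1.mul g1)).const_mul w
  have w0 := v0.congr_of_eventuallyEq (f₁ := fun y => hinge c d w y 0)
    (hev.mono fun y hy => by simp [hinge, hy])
  have w1 := v1.congr_of_eventuallyEq (f₁ := fun y => hinge c d w y 1)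
    (hev.mono fun y hy => by simp [hinge, hy])
  obtain ⟨hd, hp⟩ := differentiableAt_and_pder (v := hinge c d w) (x := x)
    (L := ![_, _]) (fun i => by
      fin_cases i
      · exact w0
      · exact w1)
  refine ⟨hd, ?_, ?_, ?_, ?_⟩ <;> rw [hp] <;> simp [← hu, ← ht] <;> field_simp
  all_goals ring

lemma hinge_eq_zero (hw : 0 < w) (hx : x 1 ≤ d) (hdoor : x 1 = d → |x 0 - c| < w) :
    hinge c d w =ᶠ[𝓝 x] fun _ => 0 := by
  rcases hx.eq_or_lt with h | h
  · exact hinge_eq_zero_door hw (hdoor h) (by simpa [h] using hw)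
  · exact hinge_eq_zero_below h

/-- The set on which the symmetric gradient of `hinge c d w` may be nonzero. -/
def strainSet (c d w : ℝ) : Set (Evec 2) :=
  {x | d < x 1 ∧ x 1 ≤ d + 2 * w ∧ |x 0 - c| ≤ 2 * w ∧ (w ≤ |x 0 - c| ∨ w ≤ x 1 - d)}

end

/-- The bounds satisfied at the point `x` by a hinge and its derivatives. -/
structure HingeBounds (K c d w : ℝ) (x : Evec 2) : Prop where
  differentiableAt : DifferentiableAt ℝ (hinge c d w) x
  abs_pder_le : ∀ i j, |pder (hinge c d w) i j x| ≤ K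
  mem_strainSet : ∀ i j, pder (hinge c d w) i j x + pder (hinge c d w) j i x ≠ 0 →
    x ∈ strainSet c d w
  abs_strain_le : d < x 1 → ∀ i j, |pder (hinge c d w) i j x + pder (hinge c d w) j i x|
    ≤ K * ((x 1 - d) / w)
  pder_eq_one : d + 2 * w < x 1 → pder (hinge c d w) 1 0 x = 1
  norm_le : ‖hinge c d w x‖ ≤ K * (|x 0 - c| + |x 1 - d| + w)

set_option maxHeartbeats 1000000 in
/-- The bounds on a hinge are uniform in its position and size. -/
lemma exists_hinge_bound : ∃ K : ℝ, 1 ≤ K ∧ ∀ (c d w : ℝ) (x : Evec 2), 0 < w →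
    (x 1 = d → |x 0 - c| < w) → HingeBounds K c d w x := by
  obtain ⟨B, hB1, hB⟩ := exists_cut_bound
  have hBB : 1 ≤ B * B := by nlinarith
  have hB_BB : B ≤ B * B := by nlinarith
  have hmul : ∀ a b : ℝ, |a| ≤ B → |b| ≤ B → |a * b| ≤ B * B := fun a b ha hb => by
    rw [abs_mul]
    exact mul_le_mul ha hb (abs_nonneg _) (by linarith)
  refine ⟨10 * (B * B), by linarith, fun c d w x hw hdoor => ?_⟩
  rcases le_or_gt (x 1) d with hx | hx
  · have h0 := hinge_eq_zero hw hx hdoor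
    obtain ⟨hd, hp⟩ := pder_eq_zero_of_eventuallyEq h0
    refine ⟨hd, fun i j => ?_, fun i j h => absurd (by simp [hp]) h,
      fun h => absurd h (not_lt.2 hx), fun h => by linarith, ?_⟩
    · rw [hp, abs_zero]
      positivity
    · rw [h0.eq_of_nhds, norm_zero]
      positivity
  · obtain ⟨hd, h00, h01, h10, h11⟩ := hinge_deriv_above (c := c) hw hx
    set u := (x 0 - c) / w with hu
    set t := (x 1 - d) / w with ht
    have ht0 : 0 < t := div_pos (by linarith) hw
    have hta : |t| = t := abs_of_pos ht0
    have hxt : x 1 - d = t * w := by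
      rw [ht, div_mul_cancel₀ _ hw.ne']
    have hxu : |x 0 - c| = |u| * w := by
      rw [hu, abs_div, abs_of_pos hw, div_mul_cancel₀ _ hw.ne']
    obtain ⟨t1, t2, -, -, -⟩ := hB t
    obtain ⟨-, -, u3, u4, u5⟩ := hB u
    have m1 := hmul _ _ t1 u5
    have m2 := hmul _ _ t1 u4
    have m3 := hmul _ _ t2 u4
    have m4 := hmul _ _ t2 u3
    have m5 := hmul _ _ t1 u3
    have hs01 : pder (hinge c d w) 0 1 x + pder (hinge c d w) 1 0 x
        = t * (deriv cut t * deriv cutId u) := by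
      rw [h01, h10]
      ring
    have h00' : pder (hinge c d w) 0 0 x = t * (cut t * deriv (deriv cutId) u) := by
      rw [h00]
      ring
    have h01' : pder (hinge c d w) 0 1 x =
        -1 + cut t * deriv cutId u + t * (deriv cut t * deriv cutId u) := by
      rw [h01]
      ring
    have small : ∀ f : ℝ, |f| ≤ B * B → (2 < t → f = 0) → |t * f| ≤ 2 * (B * B) := by
      intro f hf hf0
      rcases le_or_gt t 2 with h | h
      · rw [abs_mul, hta]
        exact mul_le_mul h hf (abs_nonneg _) (by norm_num)
      · rw [hf0 h, mul_zero, abs_zero]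
        positivity
    have s1 := small _ m1 fun h => by rw [cut_eq_zero (by rw [hta]; exact h.le), zero_mul]
    have s3 := small _ m3 fun h => by rw [deriv_cut_of_gt (by rw [hta]; exact h), zero_mul]
    have strain0 : x ∉ strainSet c d w → cut t * deriv (deriv cutId) u = 0 ∧
        deriv cut t * deriv cutId u = 0 ∧ deriv cut t * cutId u = 0 := by
      intro hx'
      rcases lt_or_ge 2 t with h | h
      · simp [cut_eq_zero (t := t) (by rw [hta]; exact h.le),
          deriv_cut_of_gt (t := t) (by rw [hta]; exact h)]
      rcases lt_or_ge 2 |u| with h' | h'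
      · simp [deriv_deriv_cutId_of_gt h', deriv_cutId_of_gt h', cutId_eq_zero h'.le]
      have hlt : |u| < 1 ∧ t < 1 := by
        by_contra hn
        apply hx'
        have h2 := mul_le_mul_of_nonneg_right h hw.le
        refine ⟨hx, by linarith, by rw [hxu]; gcongr, ?_⟩
        rw [hxu, hxt]
        by_contra! hc
        exact hn ⟨lt_of_mul_lt_mul_right (by linarith) hw.le,
          lt_of_mul_lt_mul_right (by linarith) hw.le⟩
      simp [deriv_deriv_cutId_of_lt hlt.1, deriv_cut_of_lt (t := t) (by rw [hta]; exact hlt.2)]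
    refine ⟨hd, ?_, ?_, fun _ => ?_, fun h => ?_, ?_⟩
    · have p00 : |pder (hinge c d w) 0 0 x| ≤ 10 * (B * B) := by
        rw [h00']
        linarith
      have p01 : |pder (hinge c d w) 0 1 x| ≤ 10 * (B * B) := by
        rw [h01']
        rw [abs_le] at *
        constructor <;> linarith
      have p10 : |pder (hinge c d w) 1 0 x| ≤ 10 * (B * B) := by
        rw [h10]
        rw [abs_le] at *
        constructor <;> linarith
      have p11 : |pder (hinge c d w) 1 1 x| ≤ 10 * (B * B) := by
        rw [h11, abs_neg]
        linarith
      intro i j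
      fin_cases i <;> fin_cases j
      exacts [p00, p01, p10, p11]
    · intro i j
      contrapose
      intro hx'
      obtain ⟨z1, z2, z3⟩ := strain0 hx'
      have q00 : pder (hinge c d w) 0 0 x = 0 := by rw [h00', z1, mul_zero]
      have q01 : pder (hinge c d w) 0 1 x + pder (hinge c d w) 1 0 x = 0 := by
        rw [hs01, z2, mul_zero]
      have q11 : pder (hinge c d w) 1 1 x = 0 := by rw [h11, z3, neg_zero]
      fin_cases i <;> fin_cases j
      · simp [q00]
      · exact q01
      · exact (add_comm _ _).trans q01
      · simp [q11]
    · have p00 : |pder (hinge c d w) 0 0 x + pder (hinge c d w) 0 0 x| ≤ 10 * (B * B) * t := by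
        rw [h00', ← two_mul, abs_mul, abs_mul, hta, abs_two]
        nlinarith
      have p01 : |pder (hinge c d w) 0 1 x + pder (hinge c d w) 1 0 x| ≤ 10 * (B * B) * t := by
        rw [hs01, abs_mul, hta]
        nlinarith
      have p11 : |pder (hinge c d w) 1 1 x + pder (hinge c d w) 1 1 x| ≤ 10 * (B * B) * t := by
        rw [h11, ← two_mul, abs_mul, abs_neg, abs_two]
        rcases lt_or_ge t 1 with h | h
        · rw [deriv_cut_of_lt (by rw [hta]; exact h), zero_mul, abs_zero]
          nlinarith
        · nlinarith
      intro i j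
      fin_cases i <;> fin_cases j
      exacts [p00, p01, by rw [add_comm]; exact p01, p11]
    · have : 2 < t := by
        rw [ht, lt_div_iff₀ hw]
        linarith
      rw [h10, cut_eq_zero (by rw [hta]; exact this.le), zero_mul, sub_zero]
    · refine (norm_le_abs_add_abs _).trans ?_
      have e0 : hinge c d w x 0 = w * (t * (-1 + cut t * deriv cutId u)) := by
        simp [hinge, hx, ← hu, ← ht]
        left
        ring
      have e1 : hinge c d w x 1 = w * (u - cut t * cutId u) := by
        simp [hinge, hx, ← hu, ← ht]
      rw [e0, e1, abs_mul, abs_mul, abs_mul, abs_of_pos hw, hta, hxt, hxu,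
        abs_of_pos (mul_pos ht0 hw)]
      have a0 : |-1 + cut t * deriv cutId u| ≤ 2 * (B * B) := by
        rw [abs_le] at *
        constructor <;> linarith
      have a1 : |u - cut t * cutId u| ≤ |u| + B * B :=
        (abs_sub _ _).trans (by linarith)
      have f0 := mul_le_mul_of_nonneg_left a0 (mul_pos hw ht0).le
      have f1 := mul_le_mul_of_nonneg_left a1 hw.le
      have f2 : |u| * w ≤ B * B * (|u| * w) :=
        le_mul_of_one_le_left (by positivity) hBB
      have f3 : 0 < t * w * (B * B) := by positivity
      have f4 : 0 < w * (B * B) := by positivity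
      have f5 : 0 ≤ B * B * (|u| * w) := by positivity
      linarith

/-- The constant provided by `exists_hinge_bound`. -/
def hingeConst : ℝ := exists_hinge_bound.choose

lemma one_le_hingeConst : 1 ≤ hingeConst := exists_hinge_bound.choose_spec.1

/-! ### The test fields -/

lemma pder_sum {n : ℕ} {ι : Type*} (S : Finset ι) {f : ι → Evec n → Evec n} {x : Evec n}
    (h : ∀ k ∈ S, DifferentiableAt ℝ (f k) x) (i j : Fin n) :
    pder (fun y => ∑ k ∈ S, f k y) i j x = ∑ k ∈ S, pder (f k) i j x := by
  simp only [pder]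
  rw [fderiv_fun_sum h]
  simp

lemma sqrt_sum_sq_le {A : Fin 2 → Fin 2 → ℝ} {M : ℝ} (h : ∀ i j, |A i j| ≤ M) :
    Real.sqrt (∑ i, ∑ j, A i j ^ 2) ≤ 2 * M := by
  have hM : 0 ≤ M := (abs_nonneg _).trans (h 0 0)
  refine Real.sqrt_le_iff.2 ⟨by positivity, ?_⟩
  have hsq : ∀ i j, A i j ^ 2 ≤ M ^ 2 := fun i j => sq_le_sq' (abs_le.1 (h i j)).1
    (abs_le.1 (h i j)).2
  simp only [Fin.sum_univ_two]
  linarith [hsq 0 0, hsq 0 1, hsq 1 0, hsq 1 1]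

/-- The field built from the hinges at all the doors of the `i`-th corridor. -/
def towerField (s : ℝ) (i : ℕ) (x : Evec 2) : Evec 2 :=
  if |x 0 - 10 * roomSize i| < 3 * roomSize i then
    ∑ k ∈ Finset.range (cellCount s i),
      hinge (10 * roomSize i) (4 * k * doorSize s i) (doorSize s i) x
  else 0

section

variable {s : ℝ} {i : ℕ} {x : Evec 2}

lemma hinge_spec (hx : x ∈ tower s i) {k : ℕ} (hk : k < cellCount s i) :
    HingeBounds hingeConst (10 * roomSize i) (4 * k * doorSize s i) (doorSize s i) x :=
  exists_hinge_bound.choose_spec.2 (10 * roomSize i) (4 * k * doorSize s i) (doorSize s i) x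
    (doorSize_pos s i) (abs_sub_lt_of_mem_tower_of_eq hk hx)

lemma towerField_eventuallyEq_zero (h : x 1 < 0 ∨ 3 * roomSize i < |x 0 - 10 * roomSize i|) :
    towerField s i =ᶠ[𝓝 x] fun _ => 0 := by
  have hw := doorSize_pos s i
  rcases h with h | h
  · have k1 : Continuous fun x : Evec 2 => x 1 := by fun_prop
    filter_upwards [k1.continuousAt.eventually_lt continuousAt_const h] with y hy
    have : ∀ k ∈ Finset.range (cellCount s i),
        hinge (10 * roomSize i) (4 * k * doorSize s i) (doorSize s i) y = 0 := fun k _ => by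
      have : 0 ≤ 4 * k * doorSize s i := by positivity
      rw [hinge, if_neg (by linarith)]
    simp [towerField, Finset.sum_eq_zero this]
  · have k0 : Continuous fun x : Evec 2 => |x 0 - 10 * roomSize i| := by fun_prop
    filter_upwards [continuousAt_const.eventually_lt k0.continuousAt h] with y hy
    rw [towerField, if_neg (not_lt.2 hy.le)]

lemma towerField_eventuallyEq_zero_or (hs : 1 ≤ s) (i : ℕ) (hx : x ∈ towerDomain s) :
    towerField s i =ᶠ[𝓝 x] (fun _ => 0) ∨ (x ∈ tower s i ∧ 0 ≤ x 1) := by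
  rcases lt_or_ge (x 1) 0 with h | h
  · exact Or.inl (towerField_eventuallyEq_zero (Or.inl h))
  rcases mem_towerDomain_cases hs i hx with h' | h' | h'
  · linarith
  · exact Or.inl (towerField_eventuallyEq_zero (Or.inr h'))
  · exact Or.inr ⟨h', h⟩

lemma towerField_eventuallyEq_sum (hs : 1 ≤ s) (hx : x ∈ tower s i) :
    towerField s i =ᶠ[𝓝 x] fun y => ∑ k ∈ Finset.range (cellCount s i),
      hinge (10 * roomSize i) (4 * k * doorSize s i) (doorSize s i) y := by
  have k0 : Continuous fun x : Evec 2 => |x 0 - 10 * roomSize i| := by fun_prop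
  filter_upwards [k0.continuousAt.eventually_lt continuousAt_const
    (abs_sub_lt_of_mem_tower hs hx)] with y hy
  rw [towerField, if_pos hy]

lemma differentiableAt_towerField (hs : 1 ≤ s) (hx : x ∈ tower s i) :
    DifferentiableAt ℝ (towerField s i) x :=
  (DifferentiableAt.fun_sum fun _ hk =>
    (hinge_spec hx (Finset.mem_range.1 hk)).differentiableAt).congr_of_eventuallyEq
      (towerField_eventuallyEq_sum hs hx)

lemma pder_towerField (hs : 1 ≤ s) (hx : x ∈ tower s i) (m j : Fin 2) :
    pder (towerField s i) m j x = ∑ k ∈ Finset.range (cellCount s i),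
      pder (hinge (10 * roomSize i) (4 * k * doorSize s i) (doorSize s i)) m j x := by
  rw [← pder_sum _ fun k hk => (hinge_spec hx (Finset.mem_range.1 hk)).differentiableAt,
    pder, pder, (towerField_eventuallyEq_sum hs hx).fderiv_eq]

lemma differentiableOn_towerField (hs : 1 ≤ s) (i : ℕ) :
    DifferentiableOn ℝ (towerField s i) (towerDomain s) := fun x hx => by
  rcases towerField_eventuallyEq_zero_or hs i hx with h | h
  · exact (pder_eq_zero_of_eventuallyEq h).1.differentiableWithinAt
  · exact (differentiableAt_towerField hs h.1).differentiableWithinAt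

lemma DvLen_towerField_le (hs : 1 ≤ s) (hx : x ∈ tower s i) :
    DvLen (towerField s i) x ≤ 2 * (cellCount s i * hingeConst) := by
  refine sqrt_sum_sq_le fun m j => ?_
  rw [pder_towerField hs hx]
  refine (Finset.abs_sum_le_sum_abs _ _).trans ((Finset.sum_le_card_nsmul _ _ hingeConst
    fun k hk => (hinge_spec hx (Finset.mem_range.1 hk)).abs_pder_le m j).trans_eq ?_)
  simp

lemma norm_towerField_le (hs : 1 ≤ s) (hx : x ∈ tower s i) (h1 : 0 ≤ x 1) :
    ‖towerField s i x‖ ≤ cellCount s i * (hingeConst * (19 * roomSize i)) := by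
  have hw := doorSize_pos s i
  have hr := roomSize_pos i
  rw [(towerField_eventuallyEq_sum hs hx).eq_of_nhds]
  refine (norm_sum_le _ _).trans ((Finset.sum_le_card_nsmul _ _
    (hingeConst * (19 * roomSize i)) fun k hk => ?_).trans_eq ?_)
  · refine (hinge_spec hx (Finset.mem_range.1 hk)).norm_le.trans
      (mul_le_mul_of_nonneg_left ?_ (zero_le_one.trans one_le_hingeConst))
    have e0 := abs_sub_lt_of_mem_tower hs hx
    have e1 := lt_of_mem_tower hs hx
    have e2 := index_mul_le hs (Finset.mem_range.1 hk).le
    have e3 := doorSize_le_roomSize hs i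
    have e4 : 0 ≤ k * doorSize s i := by positivity
    have e5 : |x 1 - 4 * k * doorSize s i| ≤ 15 * roomSize i :=
      abs_le.2 ⟨by linarith, by linarith⟩
    linarith
  · simp

lemma cellCount_le_DvLen_towerField (hs : 1 ≤ s) (hx : x ∈ room s i)
    (h1 : 4 * cellCount s i * doorSize s i + 2 * roomSize i ≤ x 1) :
    cellCount s i ≤ DvLen (towerField s i) x := by
  have hxt : x ∈ tower s i := Or.inr (Or.inr hx)
  have hw := doorSize_pos s i
  have hr := roomSize_pos i
  have e : pder (towerField s i) 1 0 x = cellCount s i := by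
    rw [pder_towerField hs hxt, Finset.sum_congr rfl fun k hk =>
      (hinge_spec hxt (Finset.mem_range.1 hk)).pder_eq_one ?_]
    · simp
    · have hk' : (k : ℝ) + 1 ≤ cellCount s i := by exact_mod_cast Finset.mem_range.1 hk
      have := mul_le_mul_of_nonneg_right hk' hw.le
      linarith
  refine Real.le_sqrt_of_sq_le ?_
  rw [← e]
  simp only [Fin.sum_univ_two]
  nlinarith [sq_nonneg (pder (towerField s i) 0 0 x), sq_nonneg (pder (towerField s i) 0 1 x),
    sq_nonneg (pder (towerField s i) 1 1 x)]

lemma exists_strainSet_of_epsLen_ne_zero (hs : 1 ≤ s) (hx : x ∈ towerDomain s)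
    (h : epsLen (towerField s i) x ≠ 0) : x ∈ tower s i ∧ ∃ k < cellCount s i,
      x ∈ strainSet (10 * roomSize i) (4 * k * doorSize s i) (doorSize s i) ∧
      epsLen (towerField s i) x ≤
        hingeConst * ((x 1 - 4 * k * doorSize s i) / doorSize s i) := by
  have hw := doorSize_pos s i
  rcases towerField_eventuallyEq_zero_or hs i hx with h0 | ⟨hxt, -⟩
  · simp [epsLen, (pder_eq_zero_of_eventuallyEq h0).2] at h
  have key : ∃ m j, pder (towerField s i) m j x + pder (towerField s i) j m x ≠ 0 := by
    by_contra! hn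
    exact h (by simp [epsLen, hn])
  have hsum : ∀ m j, pder (towerField s i) m j x + pder (towerField s i) j m x =
      ∑ k ∈ Finset.range (cellCount s i),
        (pder (hinge (10 * roomSize i) (4 * k * doorSize s i) (doorSize s i)) m j x +
          pder (hinge (10 * roomSize i) (4 * k * doorSize s i) (doorSize s i)) j m x) :=
    fun m j => by rw [pder_towerField hs hxt, pder_towerField hs hxt, Finset.sum_add_distrib]
  obtain ⟨m, j, hmj⟩ := key
  rw [hsum] at hmj
  obtain ⟨k, hk, hne⟩ := Finset.exists_ne_zero_of_sum_ne_zero hmj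
  have hkN := Finset.mem_range.1 hk
  have hxk := (hinge_spec hxt hkN).mem_strainSet m j hne
  refine ⟨hxt, k, hkN, hxk, ?_⟩
  have huniq : ∀ l : ℕ, x ∈ strainSet (10 * roomSize i) (4 * l * doorSize s i) (doorSize s i) →
      l = k := fun l hl => by
    obtain ⟨a1, a2, -⟩ := hxk
    obtain ⟨b1, b2, -⟩ := hl
    have c1 : (4 * k : ℝ) < 4 * l + 2 := lt_of_mul_lt_mul_right (by linarith) hw.le
    have c2 : (4 * l : ℝ) < 4 * k + 2 := lt_of_mul_lt_mul_right (by linarith) hw.le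
    norm_cast at c1 c2
    omega
  have hb : ∀ m j, |(pder (towerField s i) m j x + pder (towerField s i) j m x) / 2| ≤
      hingeConst * ((x 1 - 4 * k * doorSize s i) / doorSize s i) / 2 := fun m j => by
    rw [hsum, Finset.sum_eq_single_of_mem k hk fun l hl hlk => ?_, abs_div, abs_two]
    · have := (hinge_spec hxt hkN).abs_strain_le hxk.1 m j
      gcongr
    · by_contra hn
      exact hlk (huniq l ((hinge_spec hxt (Finset.mem_range.1 hl)).mem_strainSet m j hn))
  exact (sqrt_sum_sq_le hb).trans_eq (by ring)

lemma bdist_le_of_mem_tower (hs : 1 ≤ s) (hx : x ∈ tower s i) (h1 : 0 ≤ x 1) :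
    bdist (towerDomain s) x ≤ 6 * roomSize i := by
  have hr := roomSize_pos i
  have hz : !₂[10 * roomSize i + 3 * roomSize i, x 1] ∉ towerDomain s := by
    refine notMem_towerDomain hs (i := i) (by simpa using h1) (by simp [abs_of_pos hr])
      fun h => ?_
    have := abs_sub_lt_of_mem_tower hs h
    simp [abs_of_pos hr] at this
  refine (bdist_le_dist (Or.inr ⟨i, hx⟩) hz).trans ((dist_le_abs_add_abs _ _).trans ?_)
  obtain ⟨e1, e2⟩ := abs_lt.1 (abs_sub_lt_of_mem_tower hs hx)
  simp
  exact abs_le.2 ⟨by linarith, by linarith⟩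

lemma bdist_of_mem_strainSet (hs : 1 ≤ s) {k : ℕ} (hk : k < cellCount s i)
    (hx : x ∈ towerDomain s)
    (hxk : x ∈ strainSet (10 * roomSize i) (4 * k * doorSize s i) (doorSize s i)) :
    (x 1 - 4 * k * doorSize s i) / 2 ≤ bdist (towerDomain s) x ∧
      bdist (towerDomain s) x ≤ 3 * (x 1 - 4 * k * doorSize s i) := by
  have hw := doorSize_pos s i
  have hwr := doorSize_le_roomSize hs i
  have hr := roomSize_pos i
  obtain ⟨h1, h2, h3, h4⟩ := hxk
  obtain ⟨h5, h6⟩ := abs_le.1 h3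
  have wall : ∀ y : ℝ, doorSize s i ≤ |y - 10 * roomSize i| →
      |y - 10 * roomSize i| ≤ 3 * roomSize i →
      !₂[y, 4 * k * doorSize s i] ∉ towerDomain s := fun y hy hy' =>
    notMem_towerDomain hs (i := i) (by simp; positivity) (by simpa using hy') fun h => by
      have := abs_sub_lt_of_mem_tower_of_eq hk h (by simp)
      simp at this
      linarith
  have hz := wall (10 * roomSize i + doorSize s i) (by simp [abs_of_pos hw])
    (by simp [abs_of_pos hw]; linarith)
  refine ⟨le_bdist (isOpen_towerDomain s) hx hz
    ((ball_subset_openRect ?_ ?_ ?_ ?_).trans (cell_subset hk)), ?_⟩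
  · linarith
  · linarith
  · linarith
  · linarith
  · rcases le_or_gt (doorSize s i) |x 0 - 10 * roomSize i| with h | h
    · refine (bdist_le_dist hx (wall (x 0) h (by linarith))).trans
        ((dist_le_abs_add_abs _ _).trans ?_)
      simp
      rw [abs_of_pos (by linarith)]
      linarith
    · have h4' := h4.resolve_left (not_le.2 h)
      refine (bdist_le_dist hx hz).trans ((dist_le_abs_add_abs _ _).trans ?_)
      obtain ⟨h7, h8⟩ := abs_lt.1 h
      have e : |x 0 - (10 * roomSize i + doorSize s i)| ≤ 2 * doorSize s i :=
        abs_le.2 ⟨by linarith, by linarith⟩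
      simp
      rw [abs_of_pos (show 0 < x 1 - 4 * k * doorSize s i by linarith)]
      linarith

end

/-! ### The energies of the test fields -/

lemma rpow_le_of_mem_Icc {τ ρ : ℝ} (hτ : 0 < τ) (h1 : τ / 2 ≤ ρ) (h2 : ρ ≤ 3 * τ) (e : ℝ) :
    ρ ^ e ≤ ((1 / 2) ^ e + 3 ^ e) * τ ^ e := by
  have hτe : 0 < τ ^ e := Real.rpow_pos_of_pos hτ e
  have hA : 0 < (1 / 2 : ℝ) ^ e := Real.rpow_pos_of_pos (by norm_num) e
  have hB : 0 < (3 : ℝ) ^ e := Real.rpow_pos_of_pos (by norm_num) e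
  rcases le_total 0 e with h | h
  · refine (Real.rpow_le_rpow (by linarith) h2 h).trans ?_
    rw [Real.mul_rpow (by norm_num) hτ.le]
    gcongr
    linarith
  · refine (Real.rpow_le_rpow_of_nonpos (by linarith) h1 h).trans ?_
    rw [div_eq_inv_mul, ← one_div, Real.mul_rpow (by norm_num) hτ.le]
    gcongr
    linarith

section

variable {s p : ℝ} {i : ℕ}

lemma wIp_towerDomain_le (hs : 1 ≤ s) (hp : 0 < p) {a M : ℝ} (ha : 0 ≤ a) (i : ℕ)
    {g : Evec 2 → ℝ}
    (hg : ∀ x ∈ towerDomain s, g x ≠ 0 → x ∈ tower s i ∧ 0 ≤ x 1 ∧ |g x| ≤ M) :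
    wIp (towerDomain s) (towerDomain s) p a g ≤
      ENNReal.ofReal (M ^ p * (6 * roomSize i) ^ a * (96 * roomSize i ^ 2)) := by
  have hr := roomSize_pos i
  set R := openRect (10 * roomSize i - 3 * roomSize i) (10 * roomSize i + 3 * roomSize i)
    (-roomSize i) (15 * roomSize i) with hR
  have hRm : MeasurableSet R := (isOpen_openRect _ _ _ _).measurableSet
  have hpt : ∀ x ∈ towerDomain s, ENNReal.ofReal (|g x| ^ p * bdist (towerDomain s) x ^ a) ≤
      R.indicator (fun _ => ENNReal.ofReal (M ^ p * (6 * roomSize i) ^ a)) x := fun x hx => by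
    rcases eq_or_ne (g x) 0 with h | h
    · simp [h, Real.zero_rpow hp.ne']
    · obtain ⟨hxt, h1, hM⟩ := hg x hx h
      obtain ⟨e1, e2⟩ := abs_lt.1 (abs_sub_lt_of_mem_tower hs hxt)
      have hxR : x ∈ R := ⟨by linarith, by linarith, by linarith, lt_of_mem_tower hs hxt⟩
      rw [indicator_of_mem hxR]
      gcongr
      · exact Real.rpow_nonneg Metric.infDist_nonneg _
      · exact Real.rpow_nonneg ((abs_nonneg _).trans hM) _
      · exact Metric.infDist_nonneg
      · exact bdist_le_of_mem_tower hs hxt h1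
  calc wIp (towerDomain s) (towerDomain s) p a g
      ≤ ∫⁻ x in towerDomain s,
        R.indicator (fun _ => ENNReal.ofReal (M ^ p * (6 * roomSize i) ^ a)) x :=
        setLIntegral_mono' (isOpen_towerDomain s).measurableSet hpt
    _ ≤ ∫⁻ x, R.indicator (fun _ => ENNReal.ofReal (M ^ p * (6 * roomSize i) ^ a)) x :=
        setLIntegral_le_lintegral _ _
    _ = ENNReal.ofReal (M ^ p * (6 * roomSize i) ^ a * (96 * roomSize i ^ 2)) := by
        rw [lintegral_indicator_const hRm, hR, volume_openRect,
          ← ENNReal.ofReal_mul (by linarith), ← ENNReal.ofReal_mul' (by nlinarith)]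
        ring_nf

lemma wIp_norm_towerField_le (hs : 1 ≤ s) (hp : 0 < p) {a : ℝ} (ha : 0 ≤ a) (i : ℕ) :
    wIp (towerDomain s) (towerDomain s) p a (fun x => ‖towerField s i x‖) ≤
      ENNReal.ofReal ((cellCount s i * (hingeConst * (19 * roomSize i))) ^ p *
        (6 * roomSize i) ^ a * (96 * roomSize i ^ 2)) := by
  refine wIp_towerDomain_le hs hp ha i fun x hx h => ?_
  rcases towerField_eventuallyEq_zero_or hs i hx with h0 | ⟨hxt, h1⟩
  · simp [h0.eq_of_nhds] at h
  · exact ⟨hxt, h1, by simpa using norm_towerField_le hs hxt h1⟩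

lemma memW1Vec_towerField (hs : 1 ≤ s) (hp : 0 < p) {a : ℝ} (ha : 0 ≤ a) (i : ℕ) :
    MemW1Vec (towerDomain s) p a a (towerField s i) := by
  refine ⟨differentiableOn_towerField hs i,
    (wIp_norm_towerField_le hs hp ha i).trans_lt ENNReal.ofReal_lt_top,
    (wIp_towerDomain_le hs hp ha i (M := 2 * (cellCount s i * hingeConst))
      fun x hx h => ?_).trans_lt ENNReal.ofReal_lt_top⟩
  rcases towerField_eventuallyEq_zero_or hs i hx with h0 | ⟨hxt, h1⟩
  · simp [DvLen, (pder_eq_zero_of_eventuallyEq h0).2] at h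
  · refine ⟨hxt, h1, ?_⟩
    rw [DvLen, abs_of_nonneg (Real.sqrt_nonneg _)]
    exact DvLen_towerField_le hs hxt

lemma le_wIp_DvLen_towerField (hs : 1 ≤ s) (hp : 0 < p) {a : ℝ} (ha : 0 ≤ a) (i : ℕ) :
    ENNReal.ofReal (cellCount s i ^ p * roomSize i ^ a * (4 * roomSize i ^ 2)) ≤
      wIp (towerDomain s) (towerDomain s) p a (DvLen (towerField s i)) := by
  have hr := roomSize_pos i
  have hw := doorSize_pos s i
  set R := openRect (10 * roomSize i - roomSize i) (10 * roomSize i + roomSize i)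
    (4 * cellCount s i * doorSize s i + 2 * roomSize i)
    (4 * cellCount s i * doorSize s i + 4 * roomSize i) with hR
  have hRm : MeasurableSet R := (isOpen_openRect _ _ _ _).measurableSet
  have hRr : R ⊆ room s i := fun x ⟨h1, h2, h3, h4⟩ =>
    ⟨by linarith, by linarith, by linarith, by linarith⟩
  have hz : !₂[10 * roomSize i + 3 * roomSize i, 0] ∉ towerDomain s := by
    refine notMem_towerDomain hs (i := i) (by simp) (by simp [abs_of_pos hr]) fun h => ?_
    have := abs_sub_lt_of_mem_tower hs h
    simp [abs_of_pos hr] at this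
  have hpt : ∀ x ∈ R, ENNReal.ofReal (cellCount s i ^ p * roomSize i ^ a) ≤
      ENNReal.ofReal (|DvLen (towerField s i) x| ^ p * bdist (towerDomain s) x ^ a) :=
    fun x hx => by
      have hb : roomSize i ≤ bdist (towerDomain s) x := by
        obtain ⟨h1, h2, h3, h4⟩ := hx
        exact le_bdist (isOpen_towerDomain s) (room_subset s i (hRr ⟨h1, h2, h3, h4⟩)) hz
          ((ball_subset_openRect (by linarith) (by linarith) (by linarith) (by linarith)).trans
            (room_subset s i))
      have hD := cellCount_le_DvLen_towerField hs (hRr hx) hx.2.2.1.le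
      gcongr
      exact hD.trans (le_abs_self _)
  calc ENNReal.ofReal (cellCount s i ^ p * roomSize i ^ a * (4 * roomSize i ^ 2))
      = ∫⁻ _ in R, ENNReal.ofReal (cellCount s i ^ p * roomSize i ^ a) := by
        rw [setLIntegral_const, hR, volume_openRect,
          ← ENNReal.ofReal_mul (by linarith), ← ENNReal.ofReal_mul' (by nlinarith)]
        ring_nf
    _ ≤ ∫⁻ x in R,
        ENNReal.ofReal (|DvLen (towerField s i) x| ^ p * bdist (towerDomain s) x ^ a) :=
        setLIntegral_mono' hRm hpt
    _ ≤ wIp (towerDomain s) (towerDomain s) p a (DvLen (towerField s i)) :=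
        lintegral_mono_set (hRr.trans (room_subset s i))

lemma wIp_epsLen_towerField_le (hs : 1 ≤ s) (hp : 0 < p) {b : ℝ} (hb : -1 < b) (i : ℕ) :
    wIp (towerDomain s) (towerDomain s) p (b - p) (epsLen (towerField s i)) ≤
      ENNReal.ofReal (cellCount s i * ((hingeConst / doorSize s i) ^ p *
        ((1 / 2) ^ (b - p) + 3 ^ (b - p)) * (6 * doorSize s i *
          ((3 * doorSize s i) ^ (b + 1) / (b + 1))))) := by
  have hw := doorSize_pos s i
  have hK := zero_lt_one.trans_le one_le_hingeConst
  set A := (hingeConst / doorSize s i) ^ p * ((1 / 2) ^ (b - p) + 3 ^ (b - p)) with hA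
  have hA0 : 0 ≤ A := by positivity
  set R : ℕ → Set (Evec 2) := fun k =>
    openRect (10 * roomSize i - 3 * doorSize s i) (10 * roomSize i + 3 * doorSize s i)
      (4 * k * doorSize s i) (4 * k * doorSize s i + 3 * doorSize s i) with hR
  have hRm : ∀ k, MeasurableSet (R k) := fun k => (isOpen_openRect _ _ _ _).measurableSet
  set f : ℕ → ℝ → ℝ≥0∞ := fun k y =>
    ENNReal.ofReal A * ENNReal.ofReal ((y - 4 * k * doorSize s i) ^ b) with hf
  have hfm : ∀ k, Measurable (f k) := fun k => by fun_prop
  have hfm' : ∀ k, Measurable fun x : Evec 2 => f k (x 1) := fun k =>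
    (hfm k).comp (by fun_prop : Continuous fun x : Evec 2 => x 1).measurable
  have hpt : ∀ x ∈ towerDomain s,
      ENNReal.ofReal (|epsLen (towerField s i) x| ^ p * bdist (towerDomain s) x ^ (b - p)) ≤
        ∑ k ∈ Finset.range (cellCount s i), (R k).indicator (fun x => f k (x 1)) x :=
    fun x hx => by
    rcases eq_or_ne (epsLen (towerField s i) x) 0 with h | h
    · simp [h, Real.zero_rpow hp.ne']
    · obtain ⟨hxt, k, hk, hxk, he⟩ := exists_strainSet_of_epsLen_ne_zero hs hx h
      obtain ⟨hb1, hb2⟩ := bdist_of_mem_strainSet hs hk hx hxk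
      obtain ⟨h1, h2, h3, -⟩ := hxk
      obtain ⟨h5, h6⟩ := abs_le.1 h3
      refine le_trans ?_ (Finset.single_le_sum
        (f := fun k => (R k).indicator (fun x => f k (x 1)) x) (fun _ _ => zero_le)
        (Finset.mem_range.2 hk))
      have hxR : x ∈ R k := ⟨by linarith, by linarith, by linarith, by linarith⟩
      dsimp only
      rw [indicator_of_mem hxR, hf]
      dsimp only
      rw [← ENNReal.ofReal_mul hA0,
        abs_of_nonneg (show 0 ≤ epsLen (towerField s i) x from Real.sqrt_nonneg _)]
      set τ := x 1 - 4 * k * doorSize s i with hτ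
      have hτ0 : 0 < τ := by linarith
      refine ENNReal.ofReal_le_ofReal ?_
      calc epsLen (towerField s i) x ^ p * bdist (towerDomain s) x ^ (b - p)
          ≤ (hingeConst * (τ / doorSize s i)) ^ p *
            (((1 / 2) ^ (b - p) + 3 ^ (b - p)) * τ ^ (b - p)) := by
            gcongr
            · exact Real.rpow_nonneg Metric.infDist_nonneg _
            · exact Real.sqrt_nonneg _
            · exact rpow_le_of_mem_Icc hτ0 hb1 hb2 _
        _ = A * τ ^ b := by
            rw [hA, show hingeConst * (τ / doorSize s i) = hingeConst / doorSize s i * τ by ring,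
              Real.mul_rpow (by positivity) hτ0.le, Real.rpow_sub hτ0 b p]
            have := (Real.rpow_pos_of_pos hτ0 p).ne'
            field_simp
  calc wIp (towerDomain s) (towerDomain s) p (b - p) (epsLen (towerField s i))
      ≤ ∫⁻ x in towerDomain s,
        ∑ k ∈ Finset.range (cellCount s i), (R k).indicator (fun x => f k (x 1)) x :=
        setLIntegral_mono' (isOpen_towerDomain s).measurableSet hpt
    _ ≤ ∫⁻ x, ∑ k ∈ Finset.range (cellCount s i), (R k).indicator (fun x => f k (x 1)) x :=
        setLIntegral_le_lintegral _ _
    _ = ∑ k ∈ Finset.range (cellCount s i), ENNReal.ofReal (A * (6 * doorSize s i *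
          ((3 * doorSize s i) ^ (b + 1) / (b + 1)))) := by
        rw [lintegral_finsetSum _ fun k _ => (hfm' k).indicator (hRm k)]
        refine Finset.sum_congr rfl fun k _ => ?_
        rw [lintegral_indicator (hRm k), setLIntegral_openRect _ _ _ _ (hfm k),
          lintegral_const_mul _ (by fun_prop), setLIntegral_rpow_Ioo hb (by positivity),
          ← ENNReal.ofReal_mul hA0, ← ENNReal.ofReal_mul (by linarith)]
        ring_nf
    _ = _ := by
        rw [Finset.sum_const, Finset.card_range, nsmul_eq_mul,
          ENNReal.ofReal_mul (Nat.cast_nonneg _), ENNReal.ofReal_natCast]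

end

lemma strain_energy_le {r s N p a b K M : ℝ} (hr : 0 < r) (hp : 1 < p) (hN : r ≤ N * r ^ s)
    (hK : 0 ≤ K) (hM : 0 ≤ M) (hb : 0 < b + 1) :
    N * ((K / r ^ s) ^ p * M * (6 * r ^ s * ((3 * r ^ s) ^ (b + 1) / (b + 1)))) ≤
      N ^ p * r ^ a * r ^ 2 *
        (K ^ p * M * 6 * 3 ^ (b + 1) / (b + 1) * r ^ (s * (b + 1) - 1 - p - a)) := by
  set w := r ^ s with hw
  have hw0 : 0 < w := Real.rpow_pos_of_pos hr s
  have hN0 : 0 < N := pos_of_mul_pos_left (hr.trans_le hN) hw0.le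
  have h1 : N ≤ N ^ p * (r ^ (1 - p) * w ^ (p - 1)) := by
    have e1 : N ^ (1 - p) ≤ (r / w) ^ (1 - p) :=
      Real.rpow_le_rpow_of_nonpos (div_pos hr hw0) ((div_le_iff₀ hw0).2 hN) (by linarith)
    have e2 : (r / w) ^ (1 - p) = r ^ (1 - p) * w ^ (p - 1) := by
      rw [Real.div_rpow hr.le hw0.le, div_eq_mul_inv, ← Real.rpow_neg hw0.le, neg_sub]
    calc N = N ^ p * N ^ (1 - p) := by
          rw [← Real.rpow_add hN0, add_sub_cancel, Real.rpow_one]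
      _ ≤ _ := by
          rw [← e2]
          gcongr
  have h2 : r ^ (1 - p) * w ^ (b + 1) = r ^ a * r ^ 2 * r ^ (s * (b + 1) - 1 - p - a) := by
    rw [hw, ← Real.rpow_mul hr.le, ← Real.rpow_natCast, ← Real.rpow_add hr, ← Real.rpow_add hr,
      ← Real.rpow_add hr]
    congr 1
    push_cast
    ring
  have h3 : w ^ (p - 1) * w = w ^ p := by
    rw [← Real.rpow_add_one hw0.ne', sub_add_cancel]
  have hwp := Real.rpow_pos_of_pos hw0 p
  calc N * ((K / w) ^ p * M * (6 * w * ((3 * w) ^ (b + 1) / (b + 1))))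
      ≤ N ^ p * (r ^ (1 - p) * w ^ (p - 1)) *
        ((K / w) ^ p * M * (6 * w * ((3 * w) ^ (b + 1) / (b + 1)))) := by gcongr
    _ = N ^ p * (r ^ (1 - p) * w ^ (b + 1)) * (K ^ p * M * 6 * 3 ^ (b + 1) / (b + 1)) *
        (w ^ (p - 1) * w / w ^ p) := by
        rw [Real.div_rpow hK hw0.le, Real.mul_rpow (by norm_num) hw0.le]
        ring
    _ = _ := by
        rw [h3, div_self hwp.ne', h2]
        ring

/-- **Theorem 3.2 (sharpness).** For `s ≥ 1`, `p > 1`, `a ≥ 0` and `b` with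
`n + a < s(n + b − 1) − p + 1` (here `n = 2`), there exists a bounded `s`-John domain
`Ω ⊆ ℝ²` on which the weighted Korn inequality `(K_{p,a,b−p})` fails. -/
theorem sJohn_korn_sharp (s p a b : ℝ) (hs : 1 ≤ s) (hp : 1 < p) (ha : 0 ≤ a)
    (hab : (2 : ℝ) + a < s * ((2 : ℝ) + b - 1) - p + 1) :
    ∃ Ω : Set (Evec 2), IsSJohn Ω s ∧
      ¬ ∃ C > 0, ∀ v : Evec 2 → Evec 2, MemW1Vec Ω p a a v →
        wIp Ω Ω p a (DvLen v) ≤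
          ENNReal.ofReal C *
            (wIp Ω Ω p (b - p) (epsLen v) + wIp Ω Ω p a (fun x => ‖v x‖)) := by
  have hp0 : 0 < p := by linarith
  have hα : 0 < s * (b + 1) - 1 - p - a := by linarith
  have hb : 0 < b + 1 := pos_of_mul_pos_right (by linarith) (by linarith : (0 : ℝ) ≤ s)
  have hK := zero_lt_one.trans_le one_le_hingeConst
  refine ⟨towerDomain s, isSJohn_towerDomain hs, ?_⟩
  rintro ⟨C, hC, h⟩
  set M : ℝ := (1 / 2) ^ (b - p) + 3 ^ (b - p) with hM
  have hM0 : 0 < M := by positivity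
  set C₁ := hingeConst ^ p * M * 6 * 3 ^ (b + 1) / (b + 1)
  set C₂ := (hingeConst * 19) ^ p * 6 ^ a * 96
  have key : ∀ i, 4 ≤ C * (C₁ * roomSize i ^ (s * (b + 1) - 1 - p - a) +
      C₂ * roomSize i ^ p) := fun i => by
    have hr := roomSize_pos i
    have hN : (0 : ℝ) < cellCount s i := by exact_mod_cast one_le_cellCount s i
    have hE := strain_energy_le (a := a) hr hp (roomSize_le_cellCount_mul s i) hK.le hM0.le hb
    have hV : (cellCount s i * (hingeConst * (19 * roomSize i))) ^ p *
        (6 * roomSize i) ^ a * (96 * roomSize i ^ 2) =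
          cellCount s i ^ p * roomSize i ^ a * roomSize i ^ 2 * (C₂ * roomSize i ^ p) := by
      rw [Real.mul_rpow hN.le (by positivity), ← mul_assoc hingeConst,
        Real.mul_rpow (by positivity) hr.le, Real.mul_rpow (by norm_num) hr.le]
      ring
    have hi := (le_wIp_DvLen_towerField hs hp0 ha i).trans
      ((h _ (memW1Vec_towerField hs hp0 ha i)).trans (mul_le_mul_right (add_le_add
        ((wIp_epsLen_towerField_le hs hp0 (by linarith) i).trans
          (ENNReal.ofReal_le_ofReal hE)) (wIp_norm_towerField_le hs hp0 ha i)) _))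
    rw [hV, ← ENNReal.ofReal_add (by positivity) (by positivity), ← ENNReal.ofReal_mul hC.le,
      ENNReal.ofReal_le_ofReal_iff (by positivity)] at hi
    have hpos : 0 < cellCount s i ^ p * roomSize i ^ a * roomSize i ^ 2 := by positivity
    refine le_of_mul_le_mul_left ?_ hpos
    linarith
  have lim : ∀ e : ℝ, 0 < e → Tendsto (fun i => roomSize i ^ e) atTop (𝓝 0) := fun e he => by
    simpa [Real.zero_rpow he.ne'] using tendsto_roomSize.rpow_const (Or.inr he.le)
  have := ge_of_tendsto' ((((lim _ hα).const_mul C₁).add ((lim p hp0).const_mul C₂)).const_mul C)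
    key
  norm_num at this
end
end
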